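/- Let I ⊂ ℝ be a bounded open interval, W a double-well potential with zeros at ±1, and λ_ε > 0 a family of parameters with lim_{ε→0⁺} ε log λ_ε = k for some k ∈ (0,+∞). Then the functionals G¹_ε(v) := ε ∬_{I×I} |v(x)−v(y)|²/|x−y|² dx dy + λ_ε ∫_I W(v(x)) dx Γ-converge, as ε → 0⁺ and with respect to the L¹(I) topology, to the functional G¹(v) := 8k · H⁰(Sv) if v ∈ BV(I,{−1,1}) and +∞ otherwise, where Sv is the set of essential discontinuity points of v and H⁰ is the counting measure (so H⁰(Sv) is the number of jumps of the step function v). -/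

import Mathlib

open MeasureTheory Filter Topology Metric Set
open scoped ENNReal NNReal RealInnerProductSpace

noncomputable section

/-- `ℝⁿ` with the Euclidean structure. -/
abbrev Rn (n : ℕ) := EuclideanSpace ℝ (Fin n)

/-- A double-well potential with wells at `±1`. -/
def DoubleWell (W : ℝ → ℝ) : Prop :=
  ContDiff ℝ 2 W ∧ (∀ t, 0 ≤ W t) ∧ W 1 = 0 ∧ W (-1) = 0 ∧
    (∀ t, t ≠ 1 → t ≠ -1 → 0 < W t) ∧
    deriv W 1 = 0 ∧ deriv W (-1) = 0 ∧
    0 < iteratedDeriv 2 W 1 ∧ 0 < iteratedDeriv 2 W (-1)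

/-- Membership in `X = {u ∈ L^∞(ℝⁿ) : ‖u‖_∞ ≤ 1}`. -/
def memX (n : ℕ) (u : Rn n → ℝ) : Prop :=
  Measurable u ∧ ∀ᵐ x ∂(volume : Measure (Rn n)), |u x| ≤ 1

/-- Convergence `u_ε → u₀` in `L¹_loc(ℝⁿ)` as `ε → 0⁺`. -/
def TendstoL1loc (n : ℕ) (u : ℝ → Rn n → ℝ) (u₀ : Rn n → ℝ) : Prop :=
  ∀ K : Set (Rn n), IsCompact K →
    Tendsto (fun ε => ∫⁻ x in K, ENNReal.ofReal |u ε x - u₀ x| ∂volume)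
      (𝓝[>] (0:ℝ)) (𝓝 0)

/-- Interior interaction kernel `K^int(u,Ω)`. -/
def Kint (n : ℕ) (s : ℝ) (u : Rn n → ℝ) (Ω : Set (Rn n)) : ℝ≥0∞ :=
  ∫⁻ x in Ω, ∫⁻ y in Ω, ENNReal.ofReal (|u x - u y| ^ 2 / ‖x - y‖ ^ ((n : ℝ) + 2 * s))

/-- Exterior interaction kernel `K^ext(u,Ω)`. -/
def Kext (n : ℕ) (s : ℝ) (u : Rn n → ℝ) (Ω : Set (Rn n)) : ℝ≥0∞ :=
  2 * ∫⁻ x in Ω, ∫⁻ y in Ωᶜ, ENNReal.ofReal (|u x - u y| ^ 2 / ‖x - y‖ ^ ((n : ℝ) + 2 * s))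

/-- Potential term `∫_Ω W(u)`. -/
def PotTerm (n : ℕ) (W : ℝ → ℝ) (u : Rn n → ℝ) (Ω : Set (Rn n)) : ℝ≥0∞ :=
  ∫⁻ x in Ω, ENNReal.ofReal (W (u x))

/-- `F^int_ε` for `s ∈ (0,1/2)`. -/
def Fint (n : ℕ) (s : ℝ) (W : ℝ → ℝ) (ε : ℝ) (u : Rn n → ℝ) (Ω : Set (Rn n)) : ℝ≥0∞ :=
  Kint n s u Ω + ENNReal.ofReal (ε ^ (-(2 * s)) / 2) * PotTerm n W u Ω

/-- `F^ext_ε` for `s ∈ (0,1/2)`. -/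
def Fext (n : ℕ) (s : ℝ) (W : ℝ → ℝ) (ε : ℝ) (u : Rn n → ℝ) (Ω : Set (Rn n)) : ℝ≥0∞ :=
  Kext n s u Ω + ENNReal.ofReal (ε ^ (-(2 * s)) / 2) * PotTerm n W u Ω

/-- Interaction functional `I_s(A,B)` between disjoint sets. -/
def Is (n : ℕ) (s : ℝ) (A B : Set (Rn n)) : ℝ≥0∞ :=
  ∫⁻ x in A, ∫⁻ y in B, ENNReal.ofReal (‖x - y‖ ^ (-((n : ℝ) + 2 * s)))

/-- Interior contribution of the fractional perimeter. -/
def PerSInt (n : ℕ) (s : ℝ) (E Ω : Set (Rn n)) : ℝ≥0∞ := Is n s (E ∩ Ω) (Ω \ E)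

/-- Exterior contribution of the fractional perimeter. -/
def PerSExt (n : ℕ) (s : ℝ) (E Ω : Set (Rn n)) : ℝ≥0∞ :=
  Is n s (E \ Ω) (Ω \ E) + Is n s (E ∩ Ω) (Ωᶜ \ E)

/-- Full fractional perimeter. -/
def PerS (n : ℕ) (s : ℝ) (E Ω : Set (Rn n)) : ℝ≥0∞ := PerSInt n s E Ω + PerSExt n s E Ω

/-- `u = χ_E − χ_{ℝⁿ∖E}` a.e. in `Ω`. -/
def phaseIn (n : ℕ) (u : Rn n → ℝ) (Ω E : Set (Rn n)) : Prop :=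
  ∀ᵐ x ∂(volume.restrict Ω), (x ∈ E → u x = 1) ∧ (x ∉ E → u x = -1)

/-- Γ-convergence, as `ε → 0⁺`, in the space `X` with the `L¹_loc` topology. -/
def GammaConvergesX (n : ℕ) (Fε : ℝ → (Rn n → ℝ) → ℝ≥0∞) (F : (Rn n → ℝ) → ℝ≥0∞) : Prop :=
  (∀ u : Rn n → ℝ, memX n u → ∀ uε : ℝ → Rn n → ℝ,
      (∀ ε ∈ Ioi (0:ℝ), memX n (uε ε)) → TendstoL1loc n uε u →
      F u ≤ liminf (fun ε => Fε ε (uε ε)) (𝓝[>] (0:ℝ))) ∧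
  (∀ u : Rn n → ℝ, memX n u → ∃ uε : ℝ → Rn n → ℝ,
      (∀ ε ∈ Ioi (0:ℝ), memX n (uε ε)) ∧ TendstoL1loc n uε u ∧
      limsup (fun ε => Fε ε (uε ε)) (𝓝[>] (0:ℝ)) ≤ F u)

/-- Divergence of a vector field on `ℝⁿ`. -/
def divg (n : ℕ) (φ : Rn n → Rn n) (x : Rn n) : ℝ :=
  ∑ i : Fin n, fderiv ℝ φ x (EuclideanSpace.single i (1:ℝ)) i

/-- Classical (distributional/De Giorgi) perimeter of `E` in the open set `Ω`:
the total variation of the distributional gradient of `χ_E` in `Ω`. -/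
def Per (n : ℕ) (E Ω : Set (Rn n)) : ℝ≥0∞ :=
  ⨆ (φ : Rn n → Rn n) (_ : ContDiff ℝ 1 φ) (_ : HasCompactSupport φ)
    (_ : tsupport φ ⊆ Ω) (_ : ∀ x, ‖φ x‖ ≤ 1),
    ENNReal.ofReal (∫ x in E, divg n φ x)

/-- `Ω` has Lipschitz boundary: near every boundary point, `Ω` is the subgraph
of a Lipschitz function in some direction. -/
def HasLipschitzBoundary (n : ℕ) (Ω : Set (Rn n)) : Prop :=
  ∀ x ∈ frontier Ω, ∃ r > (0:ℝ), ∃ v : Rn n, ‖v‖ = 1 ∧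
    ∃ (L : ℝ≥0) (f : Rn n → ℝ), LipschitzWith L f ∧
      Ω ∩ ball x r = {y ∈ ball x r | ⟪y, v⟫ < f (y - ⟪y, v⟫ • v)}

/-- The reduced boundary `∂*E` (identified, as usual up to an `H^{n-1}`-negligible set,
with the measure-theoretic boundary: points where the density of `E` is neither 0 nor 1). -/
def reducedBoundary (n : ℕ) (E : Set (Rn n)) : Set (Rn n) :=
  {x : Rn n |
    ¬ Tendsto (fun r : ℝ => volume (E ∩ ball x r) / volume (ball x r)) (𝓝[>] 0) (𝓝 0) ∧
    ¬ Tendsto (fun r : ℝ => volume (E ∩ ball x r) / volume (ball x r)) (𝓝[>] 0) (𝓝 1)}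

/-- `ω_m`: Lebesgue measure of the unit ball of `ℝ^m`. -/
def omegaBall (m : ℕ) : ℝ≥0∞ := volume (ball (0 : EuclideanSpace ℝ (Fin m)) 1)

/-- Dirichlet energy `∫_Ω |∇u|²`. -/
def Dirichlet (n : ℕ) (u : Rn n → ℝ) (Ω : Set (Rn n)) : ℝ≥0∞ :=
  ∫⁻ x in Ω, ENNReal.ofReal (‖gradient u x‖ ^ 2)

/-- Allen–Cahn energy `F₁(u,Ω) = ∫_Ω |∇u|² + ∫_Ω W(u)`. -/
def AC (n : ℕ) (W : ℝ → ℝ) (u : Rn n → ℝ) (Ω : Set (Rn n)) : ℝ≥0∞ :=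
  Dirichlet n u Ω + PotTerm n W u Ω

/-- Full nonlocal kernel `K(u,Ω) = K^int + K^ext`. -/
def Kfull (n : ℕ) (s : ℝ) (u : Rn n → ℝ) (Ω : Set (Rn n)) : ℝ≥0∞ :=
  Kint n s u Ω + Kext n s u Ω

/-- Fractional Allen–Cahn energy `F₁(u,Ω) = K(u,Ω) + ∫_Ω W(u)`. -/
def FracAC (n : ℕ) (s : ℝ) (W : ℝ → ℝ) (u : Rn n → ℝ) (Ω : Set (Rn n)) : ℝ≥0∞ :=
  Kfull n s u Ω + PotTerm n W u Ω

/-- `F^int_ε` for `s ∈ [1/2,1)` (with the logarithmic scaling at `s = 1/2`). -/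
def FintH (n : ℕ) (s : ℝ) (W : ℝ → ℝ) (ε : ℝ) (u : Rn n → ℝ) (Ω : Set (Rn n)) : ℝ≥0∞ :=
  if s = (1/2 : ℝ) then
    ENNReal.ofReal |Real.log ε|⁻¹ * Kint n s u Ω
      + ENNReal.ofReal (|ε * Real.log ε|⁻¹ / 2) * PotTerm n W u Ω
  else
    ENNReal.ofReal (ε ^ (2 * s - 1)) * Kint n s u Ω
      + ENNReal.ofReal (ε⁻¹ / 2) * PotTerm n W u Ω

/-- `F^ext_ε` for `s ∈ [1/2,1)`. -/
def FextH (n : ℕ) (s : ℝ) (W : ℝ → ℝ) (ε : ℝ) (u : Rn n → ℝ) (Ω : Set (Rn n)) : ℝ≥0∞ :=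
  if s = (1/2 : ℝ) then
    ENNReal.ofReal |Real.log ε|⁻¹ * Kext n s u Ω
      + ENNReal.ofReal (|ε * Real.log ε|⁻¹ / 2) * PotTerm n W u Ω
  else
    ENNReal.ofReal (ε ^ (2 * s - 1)) * Kext n s u Ω
      + ENNReal.ofReal (ε⁻¹ / 2) * PotTerm n W u Ω

/-- `F_ε = F^int_ε + F^ext_ε` for `s ∈ [1/2,1)`. -/
def FH (n : ℕ) (s : ℝ) (W : ℝ → ℝ) (ε : ℝ) (u : Rn n → ℝ) (Ω : Set (Rn n)) : ℝ≥0∞ :=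
  FintH n s W ε u Ω + FextH n s W ε u Ω


/-- A function `v` is essentially continuous at `x`: for every `δ > 0` there is `r > 0`
such that `|v y − v z| < δ` for almost every pair `y, z` in the ball `B_r(x)`. -/
def EssCont (v : ℝ → ℝ) (x : ℝ) : Prop :=
  ∀ δ > (0:ℝ), ∃ r > (0:ℝ),
    ∀ᵐ p ∂((volume.restrict (ball x r)).prod (volume.restrict (ball x r))),
      |v p.1 - v p.2| < δ

/-- The jump set `Sv`: points of `I` at which `v` is essentially discontinuous. -/
def jumpSet (v : ℝ → ℝ) (I : Set ℝ) : Set ℝ := {x ∈ I | ¬ EssCont v x}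

/-- The approximating energies `G¹_ε` of Alberti–Bouchitté–Seppecher (dimension one). -/
def G1eps (W : ℝ → ℝ) (lam : ℝ → ℝ) (ε : ℝ) (v : ℝ → ℝ) (I : Set ℝ) : ℝ≥0∞ :=
  ENNReal.ofReal ε *
      ∫⁻ x in I, ∫⁻ y in I, ENNReal.ofReal (|v x - v y| ^ 2 / |x - y| ^ 2)
    + ENNReal.ofReal (lam ε) * ∫⁻ x in I, ENNReal.ofReal (W (v x))

open scoped Classical in
/-- The Γ-limit `G¹(v) = 8k · H⁰(Sv)` if `v ∈ BV(I,{−1,1})` (i.e. `v = ±1` a.e. in `I`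
and the jump set is finite), and `+∞` otherwise. -/
def G1lim (k : ℝ) (v : ℝ → ℝ) (I : Set ℝ) : ℝ≥0∞ :=
  if (∀ᵐ x ∂(volume.restrict I), v x = 1 ∨ v x = -1) ∧ (jumpSet v I).Finite then
    ENNReal.ofReal (8 * k * (jumpSet v I).ncard)
  else ⊤

lemma lint_shift (f : ℝ → ℝ≥0∞) (p t h : ℝ) :
    ∫⁻ x in Ico p (p+h), f (x + t) = ∫⁻ x in Ico (p+t) (p+t+h), f x := by
  have h1 := (measurePreserving_add_right (volume : Measure ℝ) t).setLIntegral_comp_preimage_emb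
    (MeasurableEquiv.addRight t).measurableEmbedding f (Ico (p+t) (p+t+h))
  rw [← h1]
  congr 2
  ext x
  simp only [mem_Ico, mem_preimage]
  constructor <;> rintro ⟨h1, h2⟩ <;> constructor <;> linarith

lemma lint_unfold (f : ℝ → ℝ≥0∞) (hf : Measurable f) (p t h : ℝ) (hh : 0 < h) (M : ℕ) :
    ∫⁻ x in Ico p (p+h), ∑ i ∈ Finset.range M, f (x + (t + i * h))
      = ∫⁻ x in Ico (p+t) (p+t+M*h), f x := by
  induction M with
  | zero => simp
  | succ M ih =>
    simp_rw [Finset.sum_range_succ]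
    rw [lintegral_add_right _ (by fun_prop), ih, lint_shift]
    have e : Ico (p+t) (p+t+((M+1 : ℕ):ℝ)*h) =
        Ico (p+t) (p+t+M*h) ∪ Ico (p+(t+M*h)) (p+(t+M*h)+h) := by
      have : (0:ℝ) ≤ M * h := by positivity
      push_cast
      rw [show p+(t+M*h) = p+t+M*h by ring, Ico_union_Ico_eq_Ico (by linarith) (by linarith)]
      congr 1; ring
    rw [e, lintegral_union measurableSet_Ico]
    rw [Set.disjoint_left]
    intro x hx hx2
    simp only [mem_Ico] at hx hx2
    linarith [hx.2, hx2.1]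

lemma exists_switch (A B : ℕ → Prop) (i j : ℕ) (hij : i < j) (hA : A i) (hB : B j)
    (hAB : ∀ l, l < j → A l ∨ B l) : ∃ l, l + 1 ≤ j ∧ A l ∧ B (l+1) := by
  obtain ⟨n, rfl⟩ : ∃ n, j = i + (n+1) := ⟨j - i - 1, by omega⟩
  clear hij
  induction n generalizing i with
  | zero => exact ⟨i, by omega, hA, hB⟩
  | succ n ih =>
    rcases hAB (i+1) (by omega) with h | h
    · have := ih (i+1) h (by convert hB using 1; omega) (fun l hl => hAB l (by omega))
      obtain ⟨l, h1, h2⟩ := this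
      exact ⟨l, by omega, h2⟩
    · exact ⟨i, by omega, hA, h⟩

lemma sum_ind_ge (m : ℕ) (hm : 0 < m) (P : ℕ → ℝ≥0∞) (h : ∀ i < m, P i = 1) :
    1 ≤ (m : ℝ≥0∞)⁻¹ * ∑ i ∈ Finset.range m, P i := by
  rw [Finset.sum_congr rfl (fun i hi => h i (Finset.mem_range.1 hi))]
  simp only [Finset.sum_const, Finset.card_range, nsmul_eq_mul, mul_one]
  rw [ENNReal.inv_mul_cancel (by exact_mod_cast hm.ne') (by simp)]

lemma phi_lower (A B : Set ℝ) (hA : MeasurableSet A) (hB : MeasurableSet B)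
    (p q ρ h η δ : ℝ) (hh : 0 < h) (hhρ : h ≤ ρ/4) (hpq : p + ρ ≤ q) (hη : 0 ≤ η)
    (h1 : volume (Ico p (p+ρ) \ A) ≤ ENNReal.ofReal (η*ρ))
    (h2 : volume (Ico q (q+ρ) \ B) ≤ ENNReal.ofReal (η*ρ))
    (h3 : volume (Ico p (q+ρ) \ (A ∪ B)) ≤ ENNReal.ofReal δ) :
    ENNReal.ofReal h ≤ volume {x | x ∈ A ∩ Ico p (q+ρ) ∧ x + h ∈ B ∩ Ico p (q+ρ)}
      + ENNReal.ofReal (4*η*h) + ENNReal.ofReal δ := by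
  have hρ : 0 < ρ := by linarith
  obtain ⟨m, hm1, hm2⟩ : ∃ m : ℕ, (m+1)*h ≤ ρ ∧ ρ < (m+2)*h := by
    have e1 := Nat.floor_le (div_nonneg hρ.le hh.le)
    have e2 := Nat.lt_floor_add_one (ρ/h)
    have : 1 ≤ ⌊ρ/h⌋₊ := by
      apply Nat.le_floor
      rw [le_div_iff₀ hh]; push_cast; linarith
    obtain ⟨m, hm⟩ := Nat.exists_eq_add_of_le' this
    rw [hm] at e1 e2
    refine ⟨m, ?_, ?_⟩
    · rw [le_div_iff₀ hh] at e1; push_cast at e1; linarith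
    · rw [div_lt_iff₀ hh] at e2; push_cast at e2; linarith
  have hmpos : 0 < m := by
    rcases Nat.eq_zero_or_pos m with h0 | h0
    · subst h0; push_cast at hm2; nlinarith
    · exact h0
  have hm3 : ρ ≤ 2 * (m * h) := by nlinarith
  obtain ⟨m', hm'1, hm'2⟩ : ∃ m' : ℕ, q - p ≤ m' * h ∧ m' * h < q - p + h := by
    have e1 := Nat.le_ceil ((q-p)/h)
    have e2 := Nat.ceil_lt_add_one (div_nonneg (by linarith : 0 ≤ q - p) hh.le)
    refine ⟨⌈(q-p)/h⌉₊, ?_, ?_⟩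
    · rwa [div_le_iff₀ hh] at e1
    · rw [← sub_lt_iff_lt_add, lt_div_iff₀ hh] at e2; linarith
  have hmm' : m ≤ m' := by
    have : (m:ℝ) * h ≤ m' * h := by nlinarith
    exact_mod_cast le_of_mul_le_mul_right this hh
  set J := Ico p (q+ρ) with hJ
  set D : Set ℝ := {x | x ∈ A ∩ J ∧ x + h ∈ B ∩ J} with hD
  have mD : MeasurableSet D := by
    apply MeasurableSet.inter (hA.inter measurableSet_Ico)
    exact measurableSet_preimage (by fun_prop) (hB.inter measurableSet_Ico)
  have mAB : MeasurableSet (A ∪ B)ᶜ := (hA.union hB).compl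
  set iD : ℝ → ℝ≥0∞ := D.indicator (fun _ => 1)
  set iA : ℝ → ℝ≥0∞ := (Aᶜ).indicator (fun _ => 1)
  set iB : ℝ → ℝ≥0∞ := (Bᶜ).indicator (fun _ => 1)
  set iC : ℝ → ℝ≥0∞ := ((A ∪ B)ᶜ).indicator (fun _ => 1)
  have miD : Measurable iD := measurable_const.indicator mD
  have miA : Measurable iA := measurable_const.indicator hA.compl
  have miB : Measurable iB := measurable_const.indicator hB.compl
  have miC : Measurable iC := measurable_const.indicator mAB
  have key : ∀ x ∈ Ico p (p+h), (1:ℝ≥0∞) ≤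
      ((∑ i ∈ Finset.range (m'+m), iD (x + (0 + i*h))
      + (m:ℝ≥0∞)⁻¹ * ∑ i ∈ Finset.range m, iA (x + (0 + i*h)))
      + (m:ℝ≥0∞)⁻¹ * ∑ i ∈ Finset.range m, iB (x + (m'*h + i*h)))
      + ∑ i ∈ Finset.range (m'+m), iC (x + (0 + i*h)) := by
    intro x hx
    by_cases c1 : ∃ i < m, x + (0 + i*h) ∈ A
    swap
    · push Not at c1
      refine le_trans (sum_ind_ge m hmpos (fun i => iA (x + (0 + i*h))) ?_) ?_
      · intro i hi; exact indicator_of_mem (c1 i hi) _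
      · exact (le_add_left le_rfl).trans (le_add_right (le_add_right le_rfl))
    by_cases c2 : ∃ i < m, x + (m'*h + i*h) ∈ B
    swap
    · push Not at c2
      refine le_trans (sum_ind_ge m hmpos (fun i => iB (x + (m'*h + i*h))) ?_) ?_
      · intro i hi; exact indicator_of_mem (c2 i hi) _
      · exact (le_add_left le_rfl).trans (le_add_right le_rfl)
    by_cases c3 : ∃ i < m'+m, x + (0 + i*h) ∈ (A ∪ B)ᶜ
    · obtain ⟨i, hi, hi2⟩ := c3
      refine le_trans ?_ (le_add_left le_rfl)
      refine le_trans ?_ (Finset.single_le_sum (f := fun i : ℕ => iC (x + (0 + i*h)))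
        (fun _ _ => zero_le) (Finset.mem_range.2 hi))
      simp only [iC]; rw [indicator_of_mem hi2]
    push Not at c3
    obtain ⟨i, hi, hiA⟩ := c1
    obtain ⟨j, hj, hjB⟩ := c2
    obtain ⟨l, hl, hlA, hlB⟩ := exists_switch (fun i => x + (0 + i*h) ∈ A)
      (fun i => x + (0 + i*h) ∈ B) i (m'+j) (by omega) hiA
      (by push_cast; convert hjB using 1; ring) (fun l hl => by
        have := c3 l (by omega)
        by_contra hc; push Not at hc; exact this (by simpa using hc))
    refine le_trans ?_ (le_add_right (le_add_right (le_add_right le_rfl)))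
    refine le_trans ?_ (Finset.single_le_sum (f := fun i : ℕ => iD (x + (0 + i*h)))
        (fun _ _ => zero_le) (Finset.mem_range.2 (show l < m'+m by omega)))
    simp only [iD]; rw [indicator_of_mem]
    have hl0 : (0:ℝ) ≤ l := by positivity
    have hl1 : (l:ℝ) + 1 ≤ m' + m - 1 := by
      have : l + 1 + 1 ≤ m' + m := by omega
      have : (l:ℝ) + 1 + 1 ≤ m' + m := by exact_mod_cast this
      linarith
    have hl2 : ((l:ℝ)+1) * h ≤ (m' + m - 1) * h := by gcongr
    have hl3 : 0 ≤ (l:ℝ) * h := by positivity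
    obtain ⟨hx1, hx2⟩ := hx
    push_cast at hlB
    refine ⟨⟨hlA, ?_⟩, ⟨by convert hlB using 1; ring, ?_⟩⟩
    · constructor <;> nlinarith
    · constructor <;> nlinarith
  have hmne : (m:ℝ≥0∞) ≠ 0 := by exact_mod_cast hmpos.ne'
  have bnd : ∀ t : ℝ≥0∞, t ≤ ENNReal.ofReal (η*ρ) → (m:ℝ≥0∞)⁻¹ * t ≤ ENNReal.ofReal (2*η*h) := by
    intro t ht
    rw [mul_comm, ← div_eq_mul_inv]
    apply ENNReal.div_le_of_le_mul
    refine ht.trans ?_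
    rw [← ENNReal.ofReal_natCast, ← ENNReal.ofReal_mul (by positivity)]
    apply ENNReal.ofReal_le_ofReal
    nlinarith
  calc ENNReal.ofReal h = ∫⁻ x in Ico p (p+h), 1 := by simp
    _ ≤ ∫⁻ x in Ico p (p+h), (((∑ i ∈ Finset.range (m'+m), iD (x + (0 + i*h))
      + (m:ℝ≥0∞)⁻¹ * ∑ i ∈ Finset.range m, iA (x + (0 + i*h)))
      + (m:ℝ≥0∞)⁻¹ * ∑ i ∈ Finset.range m, iB (x + (m'*h + i*h)))
      + ∑ i ∈ Finset.range (m'+m), iC (x + (0 + i*h))) := by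
        exact setLIntegral_mono' measurableSet_Ico key
    _ = (((∫⁻ x in Ico (p+0) (p+0+((m'+m:ℕ):ℝ)*h), iD x)
      + (m:ℝ≥0∞)⁻¹ * (∫⁻ x in Ico (p+0) (p+0+m*h), iA x))
      + (m:ℝ≥0∞)⁻¹ * (∫⁻ x in Ico (p+m'*h) (p+m'*h+m*h), iB x))
      + ∫⁻ x in Ico (p+0) (p+0+((m'+m:ℕ):ℝ)*h), iC x := by
        rw [lintegral_add_right _ (by fun_prop), lintegral_add_right _ (by fun_prop),
          lintegral_add_right _ (by fun_prop), lintegral_const_mul _ (by fun_prop),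
          lintegral_const_mul _ (by fun_prop), lint_unfold _ miD _ _ _ hh,
          lint_unfold _ miA _ _ _ hh, lint_unfold _ miB _ _ _ hh, lint_unfold _ miC _ _ _ hh]
    _ ≤ ((volume D + ENNReal.ofReal (2*η*h)) + ENNReal.ofReal (2*η*h)) + ENNReal.ofReal δ := by
        gcongr
        · refine (setLIntegral_le_lintegral _ _).trans ?_
          simp only [iD]; rw [lintegral_indicator mD]; simp
        · apply bnd
          simp only [iA]; rw [lintegral_indicator hA.compl, Measure.restrict_restrict hA.compl]
          simp only [lintegral_const, Measure.restrict_apply_univ, one_mul]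
          refine (measure_mono ?_).trans h1
          rintro x ⟨hx1, hx2, hx3⟩
          refine ⟨⟨by linarith, by nlinarith⟩, hx1⟩
        · apply bnd
          simp only [iB]; rw [lintegral_indicator hB.compl, Measure.restrict_restrict hB.compl]
          simp only [lintegral_const, Measure.restrict_apply_univ, one_mul]
          refine (measure_mono ?_).trans h2
          rintro x ⟨hx1, hx2, hx3⟩
          refine ⟨⟨by linarith, by nlinarith⟩, hx1⟩
        · simp only [iC]; rw [lintegral_indicator mAB, Measure.restrict_restrict mAB]
          simp only [lintegral_const, Measure.restrict_apply_univ, one_mul]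
          refine (measure_mono ?_).trans h3
          rintro x ⟨hx1, hx2, hx3⟩
          push_cast at hx3
          refine ⟨⟨by linarith, by nlinarith⟩, hx1⟩
    _ = _ := by
        rw [add_assoc (volume D), ← ENNReal.ofReal_add (by positivity) (by positivity)]
        congr 3; ring

lemma kernel_lower (A B J : Set ℝ) (hA : MeasurableSet A) (hB : MeasurableSet B)
    (hAJ : A ⊆ J) (hBJ : B ⊆ J) (hJ : MeasurableSet J)
    (hAB : Disjoint A B) (u : ℝ → ℝ) (κ : ℝ) (hκ0 : 0 ≤ κ)
    (hκ : ∀ x ∈ A, ∀ y ∈ B, κ ≤ |u x - u y| ^ 2) :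
    2 * (ENNReal.ofReal κ * ∫⁻ h in Ioi (0:ℝ),
        ENNReal.ofReal (1 / h^2) * volume {x | x ∈ A ∧ x + h ∈ B})
      ≤ ∫⁻ x in J, ∫⁻ y in J, ENNReal.ofReal (|u x - u y| ^ 2 / |x - y| ^ 2) := by
  classical
  set g : ℝ → ℝ → ℝ≥0∞ := fun x y =>
    if x ∈ A ∧ y ∈ B ∧ x < y then ENNReal.ofReal (κ / (y - x)^2) else 0 with hg
  have mset : MeasurableSet {p : ℝ × ℝ | p.1 ∈ A ∧ p.2 ∈ B ∧ p.1 < p.2} :=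
    (measurable_fst hA).inter ((measurable_snd hB).inter
      (measurableSet_lt measurable_fst measurable_snd))
  have mg : Measurable (Function.uncurry g) := by
    apply Measurable.ite mset _ measurable_const
    fun_prop
  have step1 : ∀ x y, g x y + g y x ≤ ENNReal.ofReal (|u x - u y| ^ 2 / |x - y| ^ 2) := by
    intro x y
    have aux : ∀ x y, x ∈ A → y ∈ B →
        ENNReal.ofReal (κ / (y-x)^2) ≤ ENNReal.ofReal (|u x - u y| ^ 2 / |x - y| ^ 2) := by
      intro x y hx hy
      apply ENNReal.ofReal_le_ofReal
      rw [sq_abs (x - y), ← neg_sub x y, neg_sq]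
      exact div_le_div_of_nonneg_right (hκ x hx y hy) (sq_nonneg _)
    simp only [hg]
    by_cases c1 : x ∈ A ∧ y ∈ B ∧ x < y
    · rw [if_pos c1, if_neg, add_zero]
      · exact aux x y c1.1 c1.2.1
      · rintro ⟨-, h2, -⟩
        exact (Set.disjoint_left.1 hAB c1.1 h2)
    · rw [if_neg c1, zero_add]
      split_ifs with c2
      · rw [abs_sub_comm (u x), abs_sub_comm x]; exact aux y x c2.1 c2.2.1
      · exact zero_le
  have step2 : ∫⁻ x in J, ∫⁻ y in J, (g x y + g y x) = 2 * ∫⁻ x in J, ∫⁻ y in J, g x y := by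
    have m2 : ∀ x, Measurable (fun y => g y x) := fun x => mg.comp (by fun_prop : Measurable (fun y : ℝ => (y, x)))
    have m3 : Measurable (fun x => ∫⁻ y in J, g y x) := by
      apply Measurable.lintegral_prod_right' (f := fun p : ℝ × ℝ => g p.2 p.1)
      exact mg.comp measurable_swap
    simp_rw [lintegral_add_right _ (m2 _)]
    rw [lintegral_add_right _ m3, two_mul]
    congr 1
    exact lintegral_lintegral_swap (f := fun x y => g y x) (mg.comp measurable_swap).aemeasurable
  have step3 : ∫⁻ x in J, ∫⁻ y in J, g x y = ∫⁻ x, ∫⁻ y, g x y := by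
    have e1 : ∀ x, ∫⁻ y in J, g x y = ∫⁻ y, g x y := by
      intro x
      rw [← lintegral_indicator hJ]
      congr 1
      rw [indicator_eq_self]
      intro y hy
      by_contra hc
      apply hy
      simp only [hg]; rw [if_neg]; rintro ⟨-, h2, -⟩; exact hc (hBJ h2)
    simp_rw [e1]
    rw [← lintegral_indicator hJ]
    congr 1
    rw [indicator_eq_self]
    intro x hx
    by_contra hc
    apply hx
    have : ∀ y, g x y = 0 := by
      intro y
      simp only [hg]; rw [if_neg]; rintro ⟨h2, -⟩; exact hc (hAJ h2)
    simp [this]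
  have step4 : ∫⁻ x, ∫⁻ y, g x y = ENNReal.ofReal κ * ∫⁻ h in Ioi (0:ℝ),
        ENNReal.ofReal (1 / h^2) * volume {x | x ∈ A ∧ x + h ∈ B} := by
    calc ∫⁻ x, ∫⁻ y, g x y = ∫⁻ x, ∫⁻ h, g x (x + h) := by
          congr 1; ext x; rw [lintegral_add_left_eq_self (fun y => g x y)]
      _ = ∫⁻ h, ∫⁻ x, g x (x + h) := by
          apply lintegral_lintegral_swap (f := fun x h => g x (x+h))
          exact (mg.comp (by fun_prop : Measurable (fun p : ℝ × ℝ => (p.1, p.1 + p.2)))).aemeasurable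
      _ = ∫⁻ h, (Ioi (0:ℝ)).indicator (fun h => ENNReal.ofReal κ * (ENNReal.ofReal (1 / h^2) *
            volume {x | x ∈ A ∧ x + h ∈ B})) h := by
          congr 1; ext h
          by_cases hh : 0 < h
          · rw [indicator_of_mem (by exact hh)]
            have : ∀ x, g x (x+h) = {x | x ∈ A ∧ x + h ∈ B}.indicator
                (fun _ => ENNReal.ofReal κ * ENNReal.ofReal (1/h^2)) x := by
              intro x
              simp only [hg, indicator, mem_ofPred_eq]
              by_cases c : x ∈ A ∧ x + h ∈ B
              · rw [if_pos ⟨c.1, c.2, by linarith⟩, if_pos c, ← ENNReal.ofReal_mul hκ0]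
                congr 1; rw [add_sub_cancel_left]; ring
              · rw [if_neg c, if_neg]
                exact fun h => c ⟨h.1, h.2.1⟩
            simp_rw [this]
            rw [lintegral_indicator]
            · simp [mul_assoc]
            · exact hA.inter (measurableSet_preimage (by fun_prop) hB)
          · rw [indicator_of_notMem (by exact hh)]
            have : ∀ x, g x (x+h) = 0 := by
              intro x; simp only [hg]; rw [if_neg]; rintro ⟨-, -, h3⟩; linarith
            simp [this]
      _ = _ := by
          rw [lintegral_indicator measurableSet_Ioi, lintegral_const_mul']
          exact ENNReal.ofReal_ne_top
  rw [← step4, ← step3, ← step2]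
  exact lintegral_mono fun x => lintegral_mono fun y => step1 x y

lemma lint_inv (c d : ℝ) (hc : 0 < c) (hcd : c ≤ d) :
    ∫⁻ h in Ioc c d, ENNReal.ofReal (1/h) = ENNReal.ofReal (Real.log (d/c)) := by
  rw [← integral_one_div_of_pos hc (by linarith), intervalIntegral.integral_of_le hcd,
    ofReal_integral_eq_lintegral_ofReal]
  · rw [← IntegrableOn, ← intervalIntegrable_iff_integrableOn_Ioc_of_le hcd]
    apply intervalIntegral.intervalIntegrable_one_div
    · intro x hx
      rw [uIcc_of_le hcd] at hx
      linarith [hx.1]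
    · fun_prop
  · refine (ae_restrict_iff' measurableSet_Ioc).2 (Eventually.of_forall fun x hx => ?_)
    have : 0 < x := hc.trans hx.1
    positivity

lemma log_lower (A B : Set ℝ) (hA : MeasurableSet A) (hB : MeasurableSet B)
    (hAB : Disjoint A B) (u : ℝ → ℝ) (κ : ℝ) (hκ0 : 0 ≤ κ)
    (hκ : ∀ x ∈ A, ∀ y ∈ B, κ ≤ |u x - u y| ^ 2)
    (p q ρ η δ : ℝ) (hδ : 0 < δ) (hρ : 0 < ρ) (hpq : p + ρ ≤ q) (hη : 0 < η) (hη5 : η < 1/5)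
    (h1 : volume (Ico p (p+ρ) \ A) ≤ ENNReal.ofReal (η*ρ))
    (h2 : volume (Ico q (q+ρ) \ B) ≤ ENNReal.ofReal (η*ρ))
    (h3 : volume (Ico p (q+ρ) \ (A ∪ B)) ≤ ENNReal.ofReal δ)
    (J : Set ℝ) (hJ : MeasurableSet J) (hJ2 : Ico p (q+ρ) ⊆ J) :
    ENNReal.ofReal (2 * κ * (1 - 5 * η) * Real.log ((ρ/4)/(δ/η))) ≤
     ∫⁻ x in J, ∫⁻ y in J, ENNReal.ofReal (|u x - u y| ^ 2 / |x - y| ^ 2) := by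
  have hc : 0 < δ / η := by positivity
  rcases le_total (ρ/4) (δ/η) with hle | hle
  · have : Real.log ((ρ/4)/(δ/η)) ≤ 0 := by
      apply Real.log_nonpos (by positivity)
      rw [div_le_one hc]; exact hle
    rw [ENNReal.ofReal_of_nonpos]
    · exact zero_le
    · apply mul_nonpos_of_nonneg_of_nonpos _ this
      apply mul_nonneg (by positivity); linarith
  refine le_trans ?_ (kernel_lower (A ∩ Ico p (q+ρ)) (B ∩ Ico p (q+ρ)) J
    (hA.inter measurableSet_Ico) (hB.inter measurableSet_Ico) (inter_subset_right.trans hJ2)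
    (inter_subset_right.trans hJ2) hJ (hAB.mono inter_subset_left inter_subset_left) u κ hκ0
    (fun x hx y hy => hκ x hx.1 y hy.1))
  have e : 2 * κ * (1 - 5 * η) * Real.log ((ρ/4)/(δ/η))
      = 2 * (κ * ((1 - 5 * η) * Real.log ((ρ/4)/(δ/η)))) := by ring
  rw [e, ENNReal.ofReal_mul (by norm_num), ENNReal.ofReal_mul hκ0,
    ENNReal.ofReal_mul (by linarith), ← lint_inv _ _ hc hle, ENNReal.ofReal_ofNat,
    ← lintegral_const_mul' _ _ ENNReal.ofReal_ne_top]
  gcongr 2 * (_ * ?_)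
  refine le_trans ?_ (lintegral_mono_set (s := Ioc (δ/η) (ρ/4)) (t := Ioi 0)
    (fun x hx => lt_trans hc hx.1))
  apply setLIntegral_mono' measurableSet_Ioc
  intro h hh
  have hh0 : 0 < h := hc.trans hh.1
  have hphi := phi_lower A B hA hB p q ρ h η δ hh0 hh.2 hpq hη.le h1 h2 h3
  have hδh : δ ≤ η * h := by
    have := hh.1; rw [div_lt_iff₀ hη] at this; linarith
  have : ENNReal.ofReal ((1 - 5*η)*h) ≤
      volume {x | x ∈ A ∩ Ico p (q+ρ) ∧ x + h ∈ B ∩ Ico p (q+ρ)} := by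
    rw [add_assoc, ← ENNReal.ofReal_add (by positivity) hδ.le, ← tsub_le_iff_right,
      ← ENNReal.ofReal_sub _ (by positivity)] at hphi
    refine le_trans (ENNReal.ofReal_le_ofReal ?_) hphi
    nlinarith
  calc _ = ENNReal.ofReal (1/h^2) * ENNReal.ofReal ((1 - 5*η)*h) := by
        rw [← ENNReal.ofReal_mul (by linarith), ← ENNReal.ofReal_mul (by positivity)]
        congr 1; field_simp
    _ ≤ _ := by gcongr

lemma density_pt (s : Set ℝ) (hs : MeasurableSet s) (hs0 : volume s ≠ 0) (η : ℝ) (hη : 0 < η) :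
    ∃ x ∈ s, ∀ᶠ r in 𝓝[>] (0:ℝ), volume (Ico (x-r) (x+r) \ s) ≤ ENNReal.ofReal (η*(2*r)) := by
  have h := Besicovitch.ae_tendsto_measure_inter_div (volume : Measure ℝ) s
  rw [ae_restrict_iff' hs] at h
  obtain ⟨x, hxs, hx⟩ : ∃ x ∈ s, Tendsto (fun r => volume (s ∩ closedBall x r) /
      volume (closedBall x r)) (𝓝[>] (0:ℝ)) (𝓝 1) := by
    by_contra hc
    push Not at hc
    apply hs0
    refine measure_mono_null ?_ (ae_iff.1 h)
    intro x hx hx2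
    exact hc x hx (hx2 hx)
  refine ⟨x, hxs, ?_⟩
  have h1 : 1 - ENNReal.ofReal η < (1:ℝ≥0∞) := by
    apply ENNReal.sub_lt_self (by simp) (by simp)
    simpa using hη
  filter_upwards [hx.eventually (lt_mem_nhds h1), self_mem_nhdsWithin] with r hr hr0
  have hr0 : 0 < r := hr0
  rw [Real.volume_closedBall] at hr
  have hpos : ENNReal.ofReal (2*r) ≠ 0 := by simpa using hr0
  have h2 : (1 - ENNReal.ofReal η) * ENNReal.ofReal (2*r) ≤ volume (s ∩ closedBall x r) := by
    rw [ENNReal.lt_div_iff_mul_lt (Or.inl hpos) (Or.inl ENNReal.ofReal_ne_top)] at hr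
    exact hr.le
  have h3 : volume (closedBall x r \ s) ≤ ENNReal.ofReal (η*(2*r)) := by
    have h4 := measure_inter_add_sdiff (μ := (volume : Measure ℝ)) (closedBall x r) hs
    rw [inter_comm, Real.volume_closedBall] at h4
    have h5 : ENNReal.ofReal (2*r) ≤ (1 - ENNReal.ofReal η) * ENNReal.ofReal (2*r)
        + ENNReal.ofReal (η*(2*r)) := by
      rw [ENNReal.ofReal_mul hη.le, ← add_mul]
      calc ENNReal.ofReal (2*r) = 1 * ENNReal.ofReal (2*r) := by simp
        _ ≤ _ := by gcongr; exact le_tsub_add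
    have h6 : volume (s ∩ closedBall x r) ≠ ⊤ :=
      measure_ne_top_of_subset inter_subset_right (by rw [Real.volume_closedBall]; exact ENNReal.ofReal_ne_top)
    rw [← ENNReal.add_le_add_iff_left h6, h4]
    exact h5.trans (by gcongr)
  refine (measure_mono ?_).trans h3
  intro y hy
  refine ⟨?_, hy.2⟩
  rw [Real.closedBall_eq_Icc]
  exact Ico_subset_Icc_self hy.1

lemma exists_windows_aux (c d x y : ℝ) (s t : Set ℝ) (hx : x ∈ Ioo c d) (hy : y ∈ Ioo c d)
    (hxy : x < y) (η : ℝ)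
    (h1 : ∀ᶠ r in 𝓝[>] (0:ℝ), volume (Ico (x-r) (x+r) \ s) ≤ ENNReal.ofReal (η*(2*r)))
    (h2 : ∀ᶠ r in 𝓝[>] (0:ℝ), volume (Ico (y-r) (y+r) \ t) ≤ ENNReal.ofReal (η*(2*r))) :
    ∃ p q ρ : ℝ, 0 < ρ ∧ p + ρ ≤ q ∧ Ico p (q+ρ) ⊆ Ioo c d ∧
      volume (Ico p (p+ρ) \ s) ≤ ENNReal.ofReal (η*ρ) ∧
      volume (Ico q (q+ρ) \ t) ≤ ENNReal.ofReal (η*ρ) := by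
  have e1 : ∀ᶠ r in 𝓝[>] (0:ℝ), r < (y-x)/2 := nhdsWithin_le_nhds (eventually_lt_nhds (by linarith))
  have e2 : ∀ᶠ r in 𝓝[>] (0:ℝ), r < x - c := nhdsWithin_le_nhds (eventually_lt_nhds (by linarith [hx.1]))
  have e3 : ∀ᶠ r in 𝓝[>] (0:ℝ), r < d - y := nhdsWithin_le_nhds (eventually_lt_nhds (by linarith [hy.2]))
  obtain ⟨r, h1, h2, e1, e2, e3, hr⟩ := (h1.and (h2.and (e1.and (e2.and (e3.and self_mem_nhdsWithin))))).exists
  have hr : 0 < r := hr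
  refine ⟨x - r, y - r, 2*r, by linarith, by linarith, ?_, ?_, ?_⟩
  · intro z hz; constructor <;> linarith [hz.1, hz.2]
  · rwa [show x - r + 2 * r = x + r by ring]
  · rwa [show y - r + 2 * r = y + r by ring]

lemma exists_windows (c d : ℝ) (s t : Set ℝ) (hs : MeasurableSet s) (ht : MeasurableSet t)
    (hst : Disjoint s t) (hs0 : volume (s ∩ Ioo c d) ≠ 0) (ht0 : volume (t ∩ Ioo c d) ≠ 0)
    (η : ℝ) (hη : 0 < η) :
    ∃ p q ρ : ℝ, 0 < ρ ∧ p + ρ ≤ q ∧ Ico p (q+ρ) ⊆ Ioo c d ∧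
      ((volume (Ico p (p+ρ) \ s) ≤ ENNReal.ofReal (η*ρ) ∧
      volume (Ico q (q+ρ) \ t) ≤ ENNReal.ofReal (η*ρ)) ∨
      (volume (Ico p (p+ρ) \ t) ≤ ENNReal.ofReal (η*ρ) ∧
      volume (Ico q (q+ρ) \ s) ≤ ENNReal.ofReal (η*ρ))) := by
  obtain ⟨x, hx, hx2⟩ := density_pt _ (hs.inter measurableSet_Ioo) hs0 η hη
  obtain ⟨y, hy, hy2⟩ := density_pt _ (ht.inter measurableSet_Ioo) ht0 η hη
  have hx2 : ∀ᶠ r in 𝓝[>] (0:ℝ), volume (Ico (x-r) (x+r) \ s) ≤ ENNReal.ofReal (η*(2*r)) := by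
    filter_upwards [hx2] with r hr
    exact (measure_mono (sdiff_subset_sdiff_right inter_subset_left)).trans hr
  have hy2 : ∀ᶠ r in 𝓝[>] (0:ℝ), volume (Ico (y-r) (y+r) \ t) ≤ ENNReal.ofReal (η*(2*r)) := by
    filter_upwards [hy2] with r hr
    exact (measure_mono (sdiff_subset_sdiff_right inter_subset_left)).trans hr
  rcases lt_trichotomy x y with h | h | h
  · obtain ⟨p, q, ρ, a1, a2, a3, a4, a5⟩ := exists_windows_aux c d x y s t hx.2 hy.2 h η hx2 hy2
    exact ⟨p, q, ρ, a1, a2, a3, Or.inl ⟨a4, a5⟩⟩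
  · subst h; exact absurd hy.1 (Set.disjoint_left.1 hst hx.1)
  · obtain ⟨p, q, ρ, a1, a2, a3, a4, a5⟩ := exists_windows_aux c d y x t s hy.2 hx.2 h η hy2 hx2
    exact ⟨p, q, ρ, a1, a2, a3, Or.inr ⟨a4, a5⟩⟩

lemma W_lower (W : ℝ → ℝ) (hW : DoubleWell W) (K : Set ℝ) (hK : IsCompact K)
    (h1 : (1:ℝ) ∉ K) (h2 : (-1:ℝ) ∉ K) : ∃ m > 0, ∀ t ∈ K, m ≤ W t := by
  obtain ⟨hc, h0, -, -, hpos, -⟩ := hW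
  rcases K.eq_empty_or_nonempty with rfl | hne
  · exact ⟨1, one_pos, by simp⟩
  obtain ⟨t, ht, hmin⟩ := hK.exists_isMinOn hne hc.continuous.continuousOn
  refine ⟨W t, hpos t (fun h => h1 (h ▸ ht)) (fun h => h2 (h ▸ ht)), fun s hs => hmin hs⟩

lemma local_lower (W : ℝ → ℝ) (hW : DoubleWell W) (k : ℝ)
    (μ : ℝ → ℝ) (hμ : ∀ ε, 0 < ε → 0 < μ ε)
    (hlim : Tendsto (fun ε => ε * Real.log (μ ε)) (𝓝[>] (0:ℝ)) (𝓝 k))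
    (c d : ℝ) (v : ℝ → ℝ) (hv : Measurable v) (vε : ℝ → ℝ → ℝ)
    (hvε : ∀ ε, 0 < ε → Measurable (vε ε))
    (hconv : Tendsto (fun ε => ∫⁻ x in Ioo c d, ENNReal.ofReal |vε ε x - v x|)
          (𝓝[>] (0:ℝ)) (𝓝 0))
    (hp : volume ({x | v x = 1} ∩ Ioo c d) ≠ 0)
    (hm : volume ({x | v x = -1} ∩ Ioo c d) ≠ 0)
    (θ T : ℝ) (hθ : θ < 8 * k) (hT : 0 < T) :
    ∀ᶠ ε in 𝓝[>] (0:ℝ),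
      ENNReal.ofReal (μ ε) * (∫⁻ x in Ioo c d, ENNReal.ofReal (W (vε ε x))) ≤ ENNReal.ofReal T →
      ENNReal.ofReal θ ≤ ENNReal.ofReal ε *
        ∫⁻ x in Ioo c d, ∫⁻ y in Ioo c d, ENNReal.ofReal (|vε ε x - vε ε y| ^ 2 / |x - y| ^ 2) := by
  obtain ⟨η, hη0, hη5, hηθ⟩ : ∃ η : ℝ, 0 < η ∧ η < 1/5 ∧
      θ < 2 * (2 - 2*η)^2 * (1 - 5*η) * k := by
    have : Tendsto (fun η : ℝ => 2 * (2 - 2*η)^2 * (1 - 5*η) * k) (𝓝[>] 0) (𝓝 (8*k)) := by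
      have h : Continuous (fun η : ℝ => 2 * (2 - 2*η)^2 * (1 - 5*η) * k) := by fun_prop
      have := h.tendsto 0
      norm_num at this
      exact this.mono_left nhdsWithin_le_nhds
    have h5 : ∀ᶠ r in 𝓝[>] (0:ℝ), r < 1/5 :=
      nhdsWithin_le_nhds (eventually_lt_nhds (show (0:ℝ) < 1/5 by norm_num))
    obtain ⟨η, h1, h2, h3⟩ := ((this.eventually (lt_mem_nhds hθ)).and
      (h5.and self_mem_nhdsWithin)).exists
    exact ⟨η, h3, h2, h1⟩
  obtain ⟨m, hm0, hmW⟩ := W_lower W hW (Icc (-1+η) (1-η)) isCompact_Icc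
    (by rintro ⟨-, h⟩; linarith) (by rintro ⟨h, -⟩; linarith)
  have ms : MeasurableSet {x | v x = 1} := hv (measurableSet_singleton 1)
  have mt : MeasurableSet {x | v x = -1} := hv (measurableSet_singleton (-1))
  obtain ⟨p, q, ρ, hρ, hpq, hsub, hwin⟩ := exists_windows c d {x | v x = 1} {x | v x = -1} ms mt
    (by rw [Set.disjoint_left]; intro x h1 h2; simp only [mem_ofPred_eq] at h1 h2; linarith)
    hp hm (η/2) (by positivity)
  have ev1 : ∀ᶠ ε in 𝓝[>] (0:ℝ), ∫⁻ x in Ioo c d, ENNReal.ofReal |vε ε x - v x|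
      < ENNReal.ofReal (η * (η/2*ρ)) :=
    hconv.eventually (gt_mem_nhds (by simp; positivity))
  set c₀ : ℝ := ρ*m*η/(4*T) with hc₀
  have hc₀pos : 0 < c₀ := by positivity
  have ev2 : ∀ᶠ ε in 𝓝[>] (0:ℝ), θ < ε * (2 * (2 - 2*η)^2 * (1 - 5*η) * (Real.log (μ ε) + Real.log c₀)) := by
    have h0 : Tendsto (fun ε : ℝ => ε) (𝓝[>] (0:ℝ)) (𝓝 0) := nhdsWithin_le_nhds
    have : Tendsto (fun ε => 2 * (2 - 2*η)^2 * (1 - 5*η) * (ε * Real.log (μ ε) + ε * Real.log c₀))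
        (𝓝[>] (0:ℝ)) (𝓝 (2 * (2 - 2*η)^2 * (1 - 5*η) * (k + 0 * Real.log c₀))) :=
      (hlim.add (h0.mul_const _)).const_mul _
    rw [zero_mul, add_zero] at this
    filter_upwards [this.eventually (lt_mem_nhds hηθ)] with ε h
    linarith
  filter_upwards [ev1, ev2, self_mem_nhdsWithin] with ε hε1 hε2 hε0 hpot
  have hε0 : 0 < ε := hε0
  have hμε := hμ ε hε0
  set u := vε ε with hu
  have mu : Measurable u := hvε ε hε0
  set A : Set ℝ := {x | 1 - η ≤ u x} with hAdef
  set B : Set ℝ := {x | u x ≤ -1 + η} with hBdef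
  have mA : MeasurableSet A := measurableSet_le measurable_const mu
  have mB : MeasurableSet B := measurableSet_le mu measurable_const
  have hAB : Disjoint A B := by
    rw [Set.disjoint_left]; intro x h1 h2; simp only [hAdef, hBdef, mem_ofPred_eq] at h1 h2; linarith
  have hE : volume ({x | η ≤ |u x - v x|} ∩ Ioo c d) ≤ ENNReal.ofReal (η/2*ρ) := by
    have h := mul_meas_ge_le_lintegral₀ (μ := volume.restrict (Ioo c d))
      (f := fun x => ENNReal.ofReal |u x - v x|) (by fun_prop) (ENNReal.ofReal η)
    have h' := h.trans hε1.le
    rw [ENNReal.ofReal_mul hη0.le, ENNReal.mul_le_mul_iff_right (by simpa using hη0) (by simp)] at h'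
    refine le_trans ?_ h'
    rw [Measure.restrict_apply' measurableSet_Ioo]
    apply measure_mono
    rintro x ⟨h1, h2⟩
    exact ⟨ENNReal.ofReal_le_ofReal h1, h2⟩
  have win : ∀ (z : ℝ) (s A' : Set ℝ), Ico z (z+ρ) ⊆ Ioo c d →
      (∀ x ∈ s, x ∉ A' → η ≤ |u x - v x|) →
      volume (Ico z (z+ρ) \ s) ≤ ENNReal.ofReal (η/2*ρ) →
      volume (Ico z (z+ρ) \ A') ≤ ENNReal.ofReal (η*ρ) := by
    intro z s A' h1 h2 h3
    calc volume (Ico z (z+ρ) \ A') ≤ volume ((Ico z (z+ρ) \ s) ∪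
          ({x | η ≤ |u x - v x|} ∩ Ioo c d)) := by
          apply measure_mono
          rintro x ⟨hx1, hx2⟩
          by_cases hxs : x ∈ s
          · exact Or.inr ⟨h2 x hxs hx2, h1 hx1⟩
          · exact Or.inl ⟨hx1, hxs⟩
      _ ≤ _ := measure_union_le _ _
      _ ≤ ENNReal.ofReal (η/2*ρ) + ENNReal.ofReal (η/2*ρ) := add_le_add h3 hE
      _ = _ := by rw [← ENNReal.ofReal_add (by positivity) (by positivity)]; congr 1; ring
  have hsA : ∀ x ∈ {x | v x = 1}, x ∉ A → η ≤ |u x - v x| := by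
    intro x h1 h2
    simp only [hAdef, mem_ofPred_eq, not_le] at h1 h2
    rw [h1, abs_sub_comm]; exact le_trans (by linarith) (le_abs_self _)
  have htB : ∀ x ∈ {x | v x = -1}, x ∉ B → η ≤ |u x - v x| := by
    intro x h1 h2
    simp only [hBdef, mem_ofPred_eq, not_le] at h1 h2
    rw [h1]; exact le_trans (by linarith) (le_abs_self _)
  have hsubp : Ico p (p+ρ) ⊆ Ioo c d := (Ico_subset_Ico_right (by linarith)).trans hsub
  have hsubq : Ico q (q+ρ) ⊆ Ioo c d := (Ico_subset_Ico_left (by linarith)).trans hsub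
  set δ : ℝ := T / (μ ε * m) with hδ
  have hδ0 : 0 < δ := by positivity
  have hC : volume (Ico p (q+ρ) \ (A ∪ B)) ≤ ENNReal.ofReal δ := by
    have hmC : MeasurableSet (Ico p (q+ρ) \ (A ∪ B)) := measurableSet_Ico.diff (mA.union mB)
    have h1 : ENNReal.ofReal m * volume (Ico p (q+ρ) \ (A ∪ B)) ≤
        ∫⁻ x in Ioo c d, ENNReal.ofReal (W (u x)) := by
      rw [← setLIntegral_const]
      refine le_trans ?_ (lintegral_mono_set (s := Ico p (q+ρ) \ (A ∪ B)) (fun x hx => hsub hx.1))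
      apply setLIntegral_mono' hmC
      rintro x ⟨hx1, hx2⟩
      apply ENNReal.ofReal_le_ofReal
      apply hmW
      simp only [hAdef, hBdef, mem_union, mem_ofPred_eq, not_or, not_le] at hx2
      exact ⟨hx2.2.le, hx2.1.le⟩
    have h2 : ENNReal.ofReal (μ ε * m) * volume (Ico p (q+ρ) \ (A ∪ B)) ≤ ENNReal.ofReal T := by
      rw [ENNReal.ofReal_mul hμε.le, mul_assoc]
      exact le_trans (by gcongr) hpot
    rw [hδ, ENNReal.ofReal_div_of_pos (by positivity), ENNReal.le_div_iff_mul_le, mul_comm]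
    · exact h2
    · left; simp; positivity
    · left; simp
  have hκ : ∀ x ∈ A, ∀ y ∈ B, (2 - 2*η)^2 ≤ |u x - u y|^2 := by
    intro x hx y hy
    simp only [hAdef, hBdef, mem_ofPred_eq] at hx hy
    rw [sq_abs]
    apply pow_le_pow_left₀ (by linarith); linarith
  have main : ENNReal.ofReal (2 * (2 - 2*η)^2 * (1 - 5 * η) * Real.log ((ρ/4)/(δ/η))) ≤
     ∫⁻ x in Ioo c d, ∫⁻ y in Ioo c d, ENNReal.ofReal (|u x - u y| ^ 2 / |x - y| ^ 2) := by
    rcases hwin with ⟨w1, w2⟩ | ⟨w1, w2⟩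
    · exact log_lower A B mA mB hAB u _ (sq_nonneg _) hκ p q ρ η δ hδ0 hρ hpq hη0 hη5
        (win p _ A hsubp hsA w1) (win q _ B hsubq htB w2) hC _ measurableSet_Ioo hsub
    · exact log_lower B A mB mA hAB.symm u _ (sq_nonneg _)
        (fun x hx y hy => by rw [abs_sub_comm]; exact hκ y hy x hx) p q ρ η δ hδ0 hρ hpq hη0 hη5
        (win p _ B hsubp htB w1) (win q _ A hsubq hsA w2) (by rwa [union_comm]) _
        measurableSet_Ioo hsub
  have hlog : Real.log ((ρ/4)/(δ/η)) = Real.log (μ ε) + Real.log c₀ := by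
    rw [← Real.log_mul hμε.ne' hc₀pos.ne']
    congr 1
    rw [hδ, hc₀]; field_simp
  rw [hlog] at main
  calc ENNReal.ofReal θ ≤ ENNReal.ofReal (ε * (2 * (2 - 2*η)^2 * (1 - 5*η) * (Real.log (μ ε) + Real.log c₀))) :=
        ENNReal.ofReal_le_ofReal hε2.le
    _ = ENNReal.ofReal ε * ENNReal.ofReal (2 * (2 - 2*η)^2 * (1 - 5*η) * (Real.log (μ ε) + Real.log c₀)) :=
        ENNReal.ofReal_mul hε0.le
    _ ≤ _ := by gcongr

lemma mu_atTop (k : ℝ) (hk : 0 < k) (μ : ℝ → ℝ) (hμ : ∀ ε, 0 < ε → 0 < μ ε)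
    (hlim : Tendsto (fun ε => ε * Real.log (μ ε)) (𝓝[>] (0:ℝ)) (𝓝 k)) :
    Tendsto μ (𝓝[>] (0:ℝ)) atTop := by
  have h1 : Tendsto (fun ε : ℝ => ε⁻¹ * (ε * Real.log (μ ε))) (𝓝[>] (0:ℝ)) atTop :=
    tendsto_inv_nhdsGT_zero.atTop_mul_pos hk hlim
  have h2 := Real.tendsto_exp_atTop.comp h1
  refine h2.congr' ?_
  filter_upwards [self_mem_nhdsWithin] with ε hε
  have hε : 0 < ε := hε
  simp only [Function.comp]
  rw [inv_mul_cancel_left₀ hε.ne', Real.exp_log (hμ ε hε)]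

lemma pot_blowup (W : ℝ → ℝ) (hW : DoubleWell W) (k : ℝ) (hk : 0 < k)
    (μ : ℝ → ℝ) (hμ : ∀ ε, 0 < ε → 0 < μ ε)
    (hlim : Tendsto (fun ε => ε * Real.log (μ ε)) (𝓝[>] (0:ℝ)) (𝓝 k))
    (a b : ℝ) (v : ℝ → ℝ) (hv : Measurable v) (vε : ℝ → ℝ → ℝ)
    (hvε : ∀ ε, 0 < ε → Measurable (vε ε))
    (hconv : Tendsto (fun ε => ∫⁻ x in Ioo a b, ENNReal.ofReal |vε ε x - v x|)
          (𝓝[>] (0:ℝ)) (𝓝 0))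
    (hnot : ¬ ∀ᵐ x ∂(volume.restrict (Ioo a b)), v x = 1 ∨ v x = -1) (T : ℝ) :
    ∀ᶠ ε in 𝓝[>] (0:ℝ), ENNReal.ofReal T ≤
      ENNReal.ofReal (μ ε) * (∫⁻ x in Ioo a b, ENNReal.ofReal (W (vε ε x))) := by
  set S : ℕ → Set ℝ := fun n => {x | |v x| ≤ n ∧ 1/((n:ℝ)+1) ≤ |v x - 1| ∧ 1/((n:ℝ)+1) ≤ |v x + 1|} ∩ Ioo a b
  have mS : ∀ n, MeasurableSet (S n) := by
    intro n
    refine MeasurableSet.inter ?_ measurableSet_Ioo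
    have m1 : Measurable (fun x => |v x|) := by fun_prop
    have m2 : Measurable (fun x => |v x - 1|) := by fun_prop
    have m3 : Measurable (fun x => |v x + 1|) := by fun_prop
    exact (measurableSet_le m1 measurable_const).inter
      ((measurableSet_le measurable_const m2).inter
      (measurableSet_le measurable_const m3))
  obtain ⟨n, hn⟩ : ∃ n, volume (S n) ≠ 0 := by
    by_contra hc
    push Not at hc
    apply hnot
    rw [ae_restrict_iff' measurableSet_Ioo, ae_iff]
    refine measure_mono_null ?_ (measure_iUnion_null hc)
    intro x hx
    simp only [mem_ofPred_eq, Classical.not_imp, not_or] at hx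
    obtain ⟨hxI, h1, h2⟩ := hx
    have p1 : 0 < |v x - 1| := abs_pos.2 (sub_ne_zero.2 h1)
    have p2 : 0 < |v x + 1| := abs_pos.2 (fun h => h2 (by linarith))
    obtain ⟨n1, hn1⟩ := exists_nat_ge |v x|
    obtain ⟨n2, hn2⟩ := exists_nat_one_div_lt p1
    obtain ⟨n3, hn3⟩ := exists_nat_one_div_lt p2
    rw [mem_iUnion]
    refine ⟨n1 + n2 + n3, ⟨?_, ?_, ?_⟩, hxI⟩
    · push_cast; linarith [(Nat.cast_nonneg n2 : (0:ℝ) ≤ n2), (Nat.cast_nonneg n3 : (0:ℝ) ≤ n3)]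
    · refine le_trans ?_ hn2.le
      apply one_div_le_one_div_of_le (by positivity)
      push_cast; linarith [(Nat.cast_nonneg n1 : (0:ℝ) ≤ n1), (Nat.cast_nonneg n3 : (0:ℝ) ≤ n3)]
    · refine le_trans ?_ hn3.le
      apply one_div_le_one_div_of_le (by positivity)
      push_cast; linarith [(Nat.cast_nonneg n1 : (0:ℝ) ≤ n1), (Nat.cast_nonneg n2 : (0:ℝ) ≤ n2)]
  set η : ℝ := 1/((n:ℝ)+1)/2 with hη
  have hη0 : 0 < η := by positivity
  set K : Set ℝ := Icc (-((n:ℝ)+η)) (n+η) ∩ ((ball 1 η)ᶜ ∩ (ball (-1) η)ᶜ)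
  obtain ⟨m, hm0, hmW⟩ := W_lower W hW K (isCompact_Icc.inter_right
    (isOpen_ball.isClosed_compl.inter isOpen_ball.isClosed_compl))
    (by rintro ⟨-, h, -⟩; exact h (mem_ball_self hη0)) (by rintro ⟨-, -, h⟩; exact h (mem_ball_self hη0))
  have hfin : volume (S n) ≠ ⊤ := measure_ne_top_of_subset inter_subset_right (by simp)
  set σ := (volume (S n)).toReal with hσ
  have hσ0 : 0 < σ := ENNReal.toReal_pos hn hfin
  have ev1 : ∀ᶠ ε in 𝓝[>] (0:ℝ), ∫⁻ x in Ioo a b, ENNReal.ofReal |vε ε x - v x|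
      < ENNReal.ofReal (η * (σ/2)) :=
    hconv.eventually (gt_mem_nhds (by simp; positivity))
  have ev2 := (mu_atTop k hk μ hμ hlim).eventually_ge_atTop (T / (m * (σ/2)))
  filter_upwards [ev1, ev2, self_mem_nhdsWithin] with ε hε1 hε2 hε0
  have hε0 : 0 < ε := hε0
  have mu := hvε ε hε0
  set u := vε ε
  have hE : volume ({x | η ≤ |u x - v x|} ∩ Ioo a b) ≤ ENNReal.ofReal (σ/2) := by
    have h := mul_meas_ge_le_lintegral₀ (μ := volume.restrict (Ioo a b))
      (f := fun x => ENNReal.ofReal |u x - v x|) (by fun_prop) (ENNReal.ofReal η)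
    have h' := h.trans hε1.le
    rw [ENNReal.ofReal_mul hη0.le, ENNReal.mul_le_mul_iff_right (by simpa using hη0) (by simp)] at h'
    refine le_trans ?_ h'
    rw [Measure.restrict_apply' measurableSet_Ioo]
    apply measure_mono
    rintro x ⟨h1, h2⟩
    exact ⟨ENNReal.ofReal_le_ofReal h1, h2⟩
  set E := {x | η ≤ |u x - v x|} ∩ Ioo a b
  have mE : MeasurableSet E :=
    (measurableSet_le measurable_const (by fun_prop)).inter measurableSet_Ioo
  have h1 : ENNReal.ofReal (σ/2) ≤ volume (S n \ E) := by
    have h2 : volume (S n) ≤ volume (S n \ E) + volume E := by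
      refine (measure_mono ?_).trans (measure_union_le _ _)
      intro x hx; by_cases h : x ∈ E
      · exact Or.inr h
      · exact Or.inl ⟨hx, h⟩
    rw [← ENNReal.ofReal_toReal hfin, ← hσ] at h2
    have h3 : ENNReal.ofReal σ = ENNReal.ofReal (σ/2) + ENNReal.ofReal (σ/2) := by
      rw [← ENNReal.ofReal_add (by positivity) (by positivity)]; congr 1; ring
    rw [h3] at h2
    have h4 := h2.trans (add_le_add_right hE (volume (S n \ E)))
    exact (ENNReal.add_le_add_iff_right ENNReal.ofReal_ne_top).1 h4
  have h2 : ENNReal.ofReal m * volume (S n \ E) ≤ ∫⁻ x in Ioo a b, ENNReal.ofReal (W (u x)) := by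
    rw [← setLIntegral_const]
    refine le_trans ?_ (lintegral_mono_set (s := S n \ E) (fun x hx => hx.1.2))
    apply setLIntegral_mono' ((mS n).diff mE)
    rintro x ⟨⟨⟨hx1, hx2, hx3⟩, hxI⟩, hxE⟩
    apply ENNReal.ofReal_le_ofReal
    apply hmW
    have hd : |u x - v x| < η := by
      by_contra hc; push Not at hc; exact hxE ⟨hc, hxI⟩
    have e : 1/((n:ℝ)+1) = 2*η := by rw [hη]; ring
    rw [e] at hx2 hx3
    have hd' := abs_lt.1 hd
    have hx1' := abs_le.1 hx1
    refine ⟨⟨by linarith, by linarith⟩, ?_, ?_⟩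
    · simp only [mem_compl_iff, mem_ball, not_lt, Real.dist_eq]
      have := abs_sub_abs_le_abs_sub (v x - 1) (u x - 1)
      rw [show v x - 1 - (u x - 1) = -(u x - v x) by ring, abs_neg] at this
      linarith
    · simp only [mem_compl_iff, mem_ball, not_lt, Real.dist_eq]
      have := abs_sub_abs_le_abs_sub (v x + 1) (u x - -1)
      rw [show v x + 1 - (u x - -1) = -(u x - v x) by ring, abs_neg] at this
      linarith
  calc ENNReal.ofReal T ≤ ENNReal.ofReal (μ ε * (m * (σ/2))) := by
        apply ENNReal.ofReal_le_ofReal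
        rwa [div_le_iff₀ (by positivity)] at hε2
    _ = ENNReal.ofReal (μ ε) * (ENNReal.ofReal m * ENNReal.ofReal (σ/2)) := by
        rw [ENNReal.ofReal_mul (hμ ε hε0).le, ENNReal.ofReal_mul hm0.le]
    _ ≤ ENNReal.ofReal (μ ε) * (ENNReal.ofReal m * volume (S n \ E)) := by gcongr
    _ ≤ _ := by gcongr

lemma essCont_of_const (v : ℝ → ℝ) (x r c : ℝ) (hr : 0 < r)
    (h : ∀ᵐ y ∂(volume.restrict (ball x r)), v y = c) : EssCont v x := by
  intro δ hδ
  refine ⟨r, hr, ?_⟩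
  have h1 := Measure.quasiMeasurePreserving_fst (μ := volume.restrict (ball x r))
    (ν := volume.restrict (ball x r)) |>.ae h
  have h2 := Measure.quasiMeasurePreserving_snd (μ := volume.restrict (ball x r))
    (ν := volume.restrict (ball x r)) |>.ae h
  filter_upwards [h1, h2] with p hp1 hp2
  rw [hp1, hp2]; simpa using hδ

lemma jump_pos (v : ℝ → ℝ) (x r : ℝ) (hr : 0 < r) (I : Set ℝ)
    (hv : ∀ᵐ x ∂(volume.restrict I), v x = 1 ∨ v x = -1) (hsub : Ioo (x-r) (x+r) ⊆ I)
    (hx : ¬ EssCont v x) :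
    volume ({x | v x = 1} ∩ Ioo (x-r) (x+r)) ≠ 0 ∧
    volume ({x | v x = -1} ∩ Ioo (x-r) (x+r)) ≠ 0 := by
  have hv' := ae_restrict_of_ae_restrict_of_subset hsub hv
  constructor
  · intro h0
    apply hx
    apply essCont_of_const v x r (-1) hr
    rw [Real.ball_eq_Ioo]
    have : ∀ᵐ y ∂(volume.restrict (Ioo (x-r) (x+r))), ¬ v y = 1 := by
      rw [ae_iff, Measure.restrict_apply' measurableSet_Ioo]
      simpa using h0
    filter_upwards [hv', this] with y h1 h2
    exact h1.resolve_left h2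
  · intro h0
    apply hx
    apply essCont_of_const v x r 1 hr
    rw [Real.ball_eq_Ioo]
    have : ∀ᵐ y ∂(volume.restrict (Ioo (x-r) (x+r))), ¬ v y = -1 := by
      rw [ae_iff, Measure.restrict_apply' measurableSet_Ioo]
      simpa using h0
    filter_upwards [hv', this] with y h1 h2
    exact h1.resolve_right h2

lemma sum_double_le (F : Finset ℝ) (J : ℝ → Set ℝ) (I : Set ℝ) (hJ : ∀ x ∈ F, MeasurableSet (J x))
    (hsub : ∀ x ∈ F, J x ⊆ I) (hd : (F : Set ℝ).PairwiseDisjoint J) (g : ℝ → ℝ → ℝ≥0∞) :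
    ∑ x ∈ F, ∫⁻ y in J x, ∫⁻ z in J x, g y z ≤ ∫⁻ y in I, ∫⁻ z in I, g y z := by
  calc ∑ x ∈ F, ∫⁻ y in J x, ∫⁻ z in J x, g y z
      ≤ ∑ x ∈ F, ∫⁻ y in J x, ∫⁻ z in I, g y z := by
        apply Finset.sum_le_sum
        intro x hx
        exact lintegral_mono fun y => lintegral_mono_set (hsub x hx)
    _ = ∫⁻ y in ⋃ x ∈ F, J x, ∫⁻ z in I, g y z := by
        rw [lintegral_biUnion_finset hd hJ]
    _ ≤ _ := lintegral_mono_set (iUnion₂_subset hsub)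

lemma lower_finset (W : ℝ → ℝ) (hW : DoubleWell W) (k : ℝ)
    (μ : ℝ → ℝ) (hμ : ∀ ε, 0 < ε → 0 < μ ε)
    (hlim : Tendsto (fun ε => ε * Real.log (μ ε)) (𝓝[>] (0:ℝ)) (𝓝 k))
    (a b : ℝ) (v : ℝ → ℝ) (hv : Measurable v) (vε : ℝ → ℝ → ℝ)
    (hvε : ∀ ε, 0 < ε → Measurable (vε ε))
    (hconv : Tendsto (fun ε => ∫⁻ x in Ioo a b, ENNReal.ofReal |vε ε x - v x|)
          (𝓝[>] (0:ℝ)) (𝓝 0))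
    (hae : ∀ᵐ x ∂(volume.restrict (Ioo a b)), v x = 1 ∨ v x = -1)
    (F : Finset ℝ) (hF : (F : Set ℝ) ⊆ jumpSet v (Ioo a b)) (t : ℝ) (ht : t < 8 * k * F.card) :
    ∀ᶠ ε in 𝓝[>] (0:ℝ), ENNReal.ofReal t ≤ ENNReal.ofReal ε *
        (∫⁻ x in Ioo a b, ∫⁻ y in Ioo a b, ENNReal.ofReal (|vε ε x - vε ε y| ^ 2 / |x - y| ^ 2)) +
      ENNReal.ofReal (μ ε) * (∫⁻ x in Ioo a b, ENNReal.ofReal (W (vε ε x))) := by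
  rcases F.eq_empty_or_nonempty with rfl | hne
  · simp at ht
    rw [ENNReal.ofReal_of_nonpos ht.le]
    simp
  have hN : (0:ℝ) < F.card := by exact_mod_cast hne.card_pos
  obtain ⟨U, hU, hUd⟩ := F.finite_toSet.t2_separation
  have hr : ∀ x, ∃ r > 0, x ∈ F → Ioo (x-r) (x+r) ⊆ U x ∩ Ioo a b := by
    intro x
    by_cases hx : x ∈ F
    · have : U x ∩ Ioo a b ∈ 𝓝 x :=
        ((hU x).2.inter isOpen_Ioo).mem_nhds ⟨(hU x).1, (hF hx).1⟩
      obtain ⟨r, hr, h⟩ := Metric.mem_nhds_iff.1 this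
      exact ⟨r, hr, fun _ => by rwa [← Real.ball_eq_Ioo]⟩
    · exact ⟨1, one_pos, fun h => absurd h hx⟩
  choose r hr0 hrs using hr
  have hθ : t / F.card < 8 * k := by rwa [div_lt_iff₀ hN]
  have ev : ∀ᶠ ε in 𝓝[>] (0:ℝ), ∀ x ∈ F,
      ENNReal.ofReal (μ ε) * (∫⁻ y in Ioo (x - r x) (x + r x), ENNReal.ofReal (W (vε ε y)))
        ≤ ENNReal.ofReal (max t 1) →
      ENNReal.ofReal (t / F.card) ≤ ENNReal.ofReal ε *
        ∫⁻ y in Ioo (x - r x) (x + r x), ∫⁻ z in Ioo (x - r x) (x + r x),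
          ENNReal.ofReal (|vε ε y - vε ε z| ^ 2 / |y - z| ^ 2) := by
    rw [Filter.eventually_all_finset]
    intro x hx
    have hs : Ioo (x - r x) (x + r x) ⊆ Ioo a b := (hrs x hx).trans inter_subset_right
    obtain ⟨j1, j2⟩ := jump_pos v x (r x) (hr0 x) _ hae hs (hF hx).2
    refine local_lower W hW k μ hμ hlim _ _ v hv vε hvε ?_ j1 j2 _ _ hθ (by positivity)
    exact tendsto_of_tendsto_of_tendsto_of_le_of_le tendsto_const_nhds hconv
      (fun _ => zero_le) (fun ε => lintegral_mono_set hs)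
  filter_upwards [ev] with ε hε
  by_cases hpot : ENNReal.ofReal (μ ε) * (∫⁻ x in Ioo a b, ENNReal.ofReal (W (vε ε x)))
      ≤ ENNReal.ofReal (max t 1)
  · refine le_trans ?_ le_self_add
    refine le_trans ?_ (mul_le_mul_right (sum_double_le F (fun x => Ioo (x - r x) (x + r x)) (Ioo a b)
      (fun _ _ => measurableSet_Ioo) (fun x hx => (hrs x hx).trans inter_subset_right) ?_ _) _)
    · rw [Finset.mul_sum]
      calc ENNReal.ofReal t = ∑ x ∈ F, ENNReal.ofReal (t / F.card) := by
            rw [Finset.sum_const, nsmul_eq_mul, ← ENNReal.ofReal_natCast,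
              ← ENNReal.ofReal_mul (by positivity)]
            congr 1; field_simp
        _ ≤ _ := by
            apply Finset.sum_le_sum
            intro x hx
            apply hε x hx
            refine le_trans ?_ hpot
            exact mul_le_mul_right (lintegral_mono_set ((hrs x hx).trans inter_subset_right)) _
    · intro x hx y hy hxy
      exact (hUd hx hy hxy).mono ((hrs x hx).trans inter_subset_left)
        ((hrs y hy).trans inter_subset_left)
  · refine le_trans ?_ le_add_self
    exact (ENNReal.ofReal_le_ofReal (le_max_left _ _)).trans (not_le.1 hpot).le

lemma gamma_liminf (W : ℝ → ℝ) (hW : DoubleWell W) (k : ℝ) (hk : 0 < k)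
    (μ : ℝ → ℝ) (hμ : ∀ ε, 0 < ε → 0 < μ ε)
    (hlim : Tendsto (fun ε => ε * Real.log (μ ε)) (𝓝[>] (0:ℝ)) (𝓝 k))
    (a b : ℝ) (v : ℝ → ℝ) (hv : Measurable v) (vε : ℝ → ℝ → ℝ)
    (hvε : ∀ ε, 0 < ε → Measurable (vε ε))
    (hconv : Tendsto (fun ε => ∫⁻ x in Ioo a b, ENNReal.ofReal |vε ε x - v x|)
          (𝓝[>] (0:ℝ)) (𝓝 0)) :
    G1lim k v (Ioo a b) ≤ liminf (fun ε => ENNReal.ofReal ε *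
        (∫⁻ x in Ioo a b, ∫⁻ y in Ioo a b, ENNReal.ofReal (|vε ε x - vε ε y| ^ 2 / |x - y| ^ 2)) +
      ENNReal.ofReal (μ ε) * (∫⁻ x in Ioo a b, ENNReal.ofReal (W (vε ε x)))) (𝓝[>] (0:ℝ)) := by
  apply le_of_forall_lt
  intro c hc
  have hctop : c ≠ ⊤ := hc.ne_top
  obtain ⟨c', hcc', hc'⟩ := exists_between hc
  refine lt_of_lt_of_le hcc' ?_
  have hc'top : c' ≠ ⊤ := hc'.ne_top
  apply le_liminf_of_le (by isBoundedDefault)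
  rw [← ENNReal.ofReal_toReal hc'top]
  unfold G1lim at hc'
  split_ifs at hc' with hcond
  · obtain ⟨hae, hfin⟩ := hcond
    apply lower_finset W hW k μ hμ hlim a b v hv vε hvε hconv hae hfin.toFinset (by simp)
    rw [← Set.ncard_eq_toFinset_card _ hfin]
    exact ((ENNReal.lt_ofReal_iff_toReal_lt hc'top).1 hc')
  · by_cases hae : ∀ᵐ x ∂(volume.restrict (Ioo a b)), v x = 1 ∨ v x = -1
    · have hinf : (jumpSet v (Ioo a b)).Infinite := fun h => hcond ⟨hae, h⟩
      obtain ⟨N, hN⟩ := exists_nat_gt (c'.toReal / (8*k))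
      obtain ⟨F, hF, hcard⟩ := hinf.exists_subset_card_eq N
      apply lower_finset W hW k μ hμ hlim a b v hv vε hvε hconv hae F hF
      rw [hcard]
      rw [div_lt_iff₀ (by positivity)] at hN; linarith
    · filter_upwards [pot_blowup W hW k hk μ hμ hlim a b v hv vε hvε hconv hae c'.toReal] with ε hε
      exact hε.trans le_add_self

def constSet (v : ℝ → ℝ) (c : ℝ) : Set ℝ :=
  {z | ∃ r > 0, ∀ᵐ y ∂(volume.restrict (ball z r)), v y = c}

lemma constSet_open (v : ℝ → ℝ) (c : ℝ) : IsOpen (constSet v c) := by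
  rw [Metric.isOpen_iff]
  rintro z ⟨r, hr, h⟩
  refine ⟨r, hr, fun z' hz' => ⟨r - dist z' z, by simpa using hz', ?_⟩⟩
  refine ae_restrict_of_ae_restrict_of_subset (ball_subset_ball' ?_) h
  linarith

lemma constSet_disj (v : ℝ → ℝ) : Disjoint (constSet v 1) (constSet v (-1)) := by
  rw [Set.disjoint_left]
  rintro z ⟨r, hr, h⟩ ⟨r', hr', h'⟩
  have h1 := ae_restrict_of_ae_restrict_of_subset (ball_subset_ball (min_le_left r r')) h
  have h2 := ae_restrict_of_ae_restrict_of_subset (ball_subset_ball (min_le_right r r')) h'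
  have : ∀ᵐ y ∂(volume.restrict (ball z (min r r'))), False := by
    filter_upwards [h1, h2] with y a b
    rw [a] at b; norm_num at b
  rw [ae_iff] at this
  simp at this
  rcases this with h | h <;> linarith

lemma constSet_cover (v : ℝ → ℝ) (I : Set ℝ) (hI : IsOpen I)
    (hae : ∀ᵐ x ∂(volume.restrict I), v x = 1 ∨ v x = -1) (z : ℝ) (hz : z ∈ I)
    (hS : z ∉ jumpSet v I) : z ∈ constSet v 1 ∪ constSet v (-1) := by
  have hE : EssCont v z := by
    by_contra h; exact hS ⟨hz, h⟩
  obtain ⟨r, hr, h⟩ := hE 1 one_pos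
  obtain ⟨r', hr', h'⟩ := Metric.isOpen_iff.1 hI z hz
  have h1 := Measure.ae_ae_of_ae_prod h
  have h2 := ae_restrict_of_ae_restrict_of_subset (ball_subset_ball (min_le_left r r')) h1
  have h3 := ae_restrict_of_ae_restrict_of_subset
    ((ball_subset_ball (min_le_right r r')).trans h') hae
  have hpos : 0 < min r r' := lt_min hr hr'
  have hne : volume.restrict (ball z (min r r')) ≠ 0 := by
    rw [Ne, Measure.restrict_eq_zero]
    exact (measure_ball_pos _ _ hpos).ne'
  have : NeBot (ae (volume.restrict (ball z (min r r')))) := ae_neBot.2 hne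
  obtain ⟨x, hx1, hx2⟩ := (h2.and h3).exists
  have hx1' := ae_restrict_of_ae_restrict_of_subset (ball_subset_ball (min_le_left r r')) hx1
  rcases hx2 with hx2 | hx2
  · refine Or.inl ⟨_, hpos, ?_⟩
    filter_upwards [hx1', h3] with y h4 h5
    rcases h5 with h5 | h5
    · exact h5
    · simp only [hx2, h5] at h4; norm_num at h4
  · refine Or.inr ⟨_, hpos, ?_⟩
    filter_upwards [hx1', h3] with y h4 h5
    rcases h5 with h5 | h5
    · simp only [hx2, h5] at h4; norm_num at h4
    · exact h5

lemma constSet_null (v : ℝ → ℝ) (c : ℝ) : volume {x | x ∈ constSet v c ∧ v x ≠ c} = 0 := by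
  apply measure_null_of_locally_null
  rintro x ⟨⟨r, hr, h⟩, -⟩
  refine ⟨{y | v y ≠ c} ∩ ball x r, ?_, ?_⟩
  · rw [mem_nhdsWithin]
    refine ⟨ball x r, isOpen_ball, mem_ball_self hr, ?_⟩
    rintro y ⟨hy1, hy2⟩
    exact ⟨hy2.2, hy1⟩
  · rw [ae_iff, Measure.restrict_apply' measurableSet_ball] at h
    exact h

lemma step_rep (a b : ℝ) (v : ℝ → ℝ)
    (hae : ∀ᵐ x ∂(volume.restrict (Ioo a b)), v x = 1 ∨ v x = -1)
    (hfin : (jumpSet v (Ioo a b)).Finite) :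
    ∃ w : ℝ → ℝ, Measurable w ∧ (∀ x, w x = 1 ∨ w x = -1) ∧
      (∀ x ∈ Ioo a b, ∀ y ∈ Ioo a b, x ≤ y →
        (∀ s ∈ jumpSet v (Ioo a b), ¬ (x ≤ s ∧ s ≤ y)) → w x = w y) ∧
      ∀ᵐ x ∂(volume.restrict (Ioo a b)), w x = v x := by
  classical
  refine ⟨fun x => if x ∈ constSet v 1 then 1 else -1, ?_, ?_, ?_, ?_⟩
  · exact Measurable.ite (constSet_open v 1).measurableSet measurable_const measurable_const
  · intro x; dsimp only; split_ifs <;> simp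
  · intro x hx y hy hxy hs
    have hsub : Icc x y ⊆ constSet v 1 ∪ constSet v (-1) := by
      intro z hz
      exact constSet_cover v _ isOpen_Ioo hae z ⟨hx.1.trans_le hz.1, hz.2.trans_lt hy.2⟩
        (fun h => hs z h hz)
    have := isPreconnected_Icc.subset_or_subset (constSet_open v 1) (constSet_open v (-1))
      (constSet_disj v) hsub
    dsimp only
    rcases this with h | h
    · rw [if_pos (h (left_mem_Icc.2 hxy)), if_pos (h (right_mem_Icc.2 hxy))]
    · rw [if_neg, if_neg]
      · exact fun h' => Set.disjoint_left.1 (constSet_disj v) h' (h (right_mem_Icc.2 hxy))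
      · exact fun h' => Set.disjoint_left.1 (constSet_disj v) h' (h (left_mem_Icc.2 hxy))
  · rw [ae_restrict_iff' measurableSet_Ioo, ae_iff]
    refine measure_mono_null ?_ (measure_union_null (hfin.measure_zero volume)
      (measure_union_null (constSet_null v 1) (constSet_null v (-1))))
    intro x hx
    simp only [mem_ofPred_eq, Classical.not_imp] at hx
    obtain ⟨hxI, hx2⟩ := hx
    by_cases hS : x ∈ jumpSet v (Ioo a b)
    · exact Or.inl hS
    right
    rcases constSet_cover v _ isOpen_Ioo hae x hxI hS with h | h
    · rw [if_pos h] at hx2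
      exact Or.inl ⟨h, fun h' => hx2 h'.symm⟩
    · rw [if_neg (fun h' => Set.disjoint_left.1 (constSet_disj v) h' h)] at hx2
      exact Or.inr ⟨h, fun h' => hx2 h'.symm⟩

lemma tail_right (x s : ℝ) (hxs : x < s) :
    ∫⁻ y in Ici s, ENNReal.ofReal (4/(x-y)^2) = ENNReal.ofReal (4/(s-x)) := by
  have hd : ∀ y ∈ Ici s, HasDerivAt (fun y => -4/(y-x)) (4/(x-y)^2) y := by
    intro y hy
    have hy : s ≤ y := hy
    have hne : y - x ≠ 0 := by linarith
    have h : HasDerivAt (fun y => -4 * (y-x)⁻¹) (-4 * (-1/(y-x)^2)) y :=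
      (((hasDerivAt_id y).sub_const x).inv hne).const_mul (-4)
    have e1 : (fun y : ℝ => -4/(y-x)) = fun y => -4 * (y-x)⁻¹ := by
      ext z; rw [div_eq_mul_inv]
    have e2 : 4/(x-y)^2 = -4 * (-1/(y-x)^2) := by
      rw [← neg_sub y x, neg_sq]; ring
    rw [e1, e2]; exact h
  have ht : Tendsto (fun y => -4/(y-x)) atTop (𝓝 0) := by
    apply Tendsto.const_div_atTop
    exact tendsto_atTop_add_const_right _ (-x) tendsto_id
  have hpos : ∀ y ∈ Ioi s, 0 ≤ 4/(x-y)^2 := fun y _ => by positivity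
  have hintg := integrableOn_Ioi_deriv_of_nonneg' hd hpos ht
  have hval := integral_Ioi_of_hasDerivAt_of_tendsto' hd hintg ht
  rw [setLIntegral_congr Ioi_ae_eq_Ici.symm, ← ofReal_integral_eq_lintegral_ofReal hintg, hval]
  · congr 1; ring
  · exact Eventually.of_forall fun y => by positivity

lemma tail_left (x s : ℝ) (hxs : s < x) :
    ∫⁻ y in Iic s, ENNReal.ofReal (4/(x-y)^2) = ENNReal.ofReal (4/(x-s)) := by
  have h := (Measure.measurePreserving_neg (volume : Measure ℝ)).setLIntegral_comp_preimage_emb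
    (MeasurableEquiv.neg ℝ).measurableEmbedding (fun y => ENNReal.ofReal (4/(x-y)^2)) (Iic s)
  rw [← h]
  have e : (Neg.neg ⁻¹' Iic s : Set ℝ) = Ici (-s) := by ext y; simp
  rw [e]
  have h2 := tail_right (-x) (-s) (by linarith)
  rw [show -s - -x = x - s by ring] at h2
  rw [← h2]
  congr 1; ext y; congr 2; ring

lemma inner_all (x δ : ℝ) (hδ : 0 < δ) :
    ∫⁻ y, ENNReal.ofReal (min (4/(x-y)^2) (1/δ^2)) ≤ ENNReal.ofReal (10/δ) := by
  have hu : (univ : Set ℝ) = (Ioo (x-δ) (x+δ) ∪ Ici (x+δ)) ∪ Iic (x-δ) := by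
    ext y; simp only [mem_univ, mem_union, mem_Ioo, mem_Ici, mem_Iic, true_iff]
    by_cases h1 : y ≤ x - δ
    · exact Or.inr h1
    · by_cases h2 : x + δ ≤ y
      · exact Or.inl (Or.inr h2)
      · exact Or.inl (Or.inl ⟨by linarith, by linarith⟩)
  rw [← setLIntegral_univ, hu]
  refine (lintegral_union_le _ _ _).trans ?_
  refine (add_le_add_left (lintegral_union_le _ _ _) _).trans ?_
  have b1 : ∫⁻ y in Ioo (x-δ) (x+δ), ENNReal.ofReal (min (4/(x-y)^2) (1/δ^2)) ≤ ENNReal.ofReal (2/δ) := by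
    calc _ ≤ ∫⁻ y in Ioo (x-δ) (x+δ), ENNReal.ofReal (1/δ^2) :=
          lintegral_mono fun y => ENNReal.ofReal_le_ofReal (min_le_right _ _)
      _ = _ := by
          rw [setLIntegral_const, Real.volume_Ioo, ← ENNReal.ofReal_mul (by positivity)]
          congr 1; field_simp; ring
  have b2 : ∫⁻ y in Ici (x+δ), ENNReal.ofReal (min (4/(x-y)^2) (1/δ^2)) ≤ ENNReal.ofReal (4/δ) := by
    calc _ ≤ ∫⁻ y in Ici (x+δ), ENNReal.ofReal (4/(x-y)^2) :=
          lintegral_mono fun y => ENNReal.ofReal_le_ofReal (min_le_left _ _)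
      _ = _ := by rw [tail_right x (x+δ) (by linarith)]; congr 2; ring
  have b3 : ∫⁻ y in Iic (x-δ), ENNReal.ofReal (min (4/(x-y)^2) (1/δ^2)) ≤ ENNReal.ofReal (4/δ) := by
    calc _ ≤ ∫⁻ y in Iic (x-δ), ENNReal.ofReal (4/(x-y)^2) :=
          lintegral_mono fun y => ENNReal.ofReal_le_ofReal (min_le_left _ _)
      _ = _ := by rw [tail_left x (x-δ) (by linarith)]; congr 2; ring
  refine (add_le_add (add_le_add b1 b2) b3).trans ?_
  rw [← ENNReal.ofReal_add (by positivity) (by positivity),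
    ← ENNReal.ofReal_add (by positivity) (by positivity)]
  apply ENNReal.ofReal_le_ofReal
  apply le_of_eq; ring

lemma outer_right (s δ L : ℝ) (hδ : 0 < δ) (hL : δ ≤ L) :
    ∫⁻ x in Icc (s-L) (s-δ), ENNReal.ofReal (4/(s-x)) = ENNReal.ofReal (4 * Real.log (L/δ)) := by
  have h := (Measure.measurePreserving_sub_left (volume : Measure ℝ) s).setLIntegral_comp_preimage_emb
    (MeasurableEquiv.subLeft s).measurableEmbedding (fun h => ENNReal.ofReal (4/h)) (Icc δ L)
  have e : ((fun x => s - x) ⁻¹' Icc δ L : Set ℝ) = Icc (s-L) (s-δ) := by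
    ext y; simp only [mem_preimage, mem_Icc]; constructor <;> rintro ⟨h1, h2⟩ <;> constructor <;> linarith
  rw [e] at h
  rw [h, setLIntegral_congr Ioc_ae_eq_Icc.symm, ENNReal.ofReal_mul (by norm_num),
    ← lint_inv δ L hδ hL, ← lintegral_const_mul' _ _ ENNReal.ofReal_ne_top]
  congr 1; ext y
  rw [← ENNReal.ofReal_mul (by norm_num)]; congr 1; ring

lemma outer_left (s δ L : ℝ) (hδ : 0 < δ) (hL : δ ≤ L) :
    ∫⁻ x in Icc (s+δ) (s+L), ENNReal.ofReal (4/(x-s)) = ENNReal.ofReal (4 * Real.log (L/δ)) := by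
  have h := (measurePreserving_sub_right (volume : Measure ℝ) s).setLIntegral_comp_preimage_emb
    (MeasurableEquiv.subRight s).measurableEmbedding (fun h => ENNReal.ofReal (4/h)) (Icc δ L)
  have e : ((fun x => x - s) ⁻¹' Icc δ L : Set ℝ) = Icc (s+δ) (s+L) := by
    ext y; simp only [mem_preimage, mem_Icc]; constructor <;> rintro ⟨h1, h2⟩ <;> constructor <;> linarith
  rw [e] at h
  rw [h, setLIntegral_congr Ioc_ae_eq_Icc.symm, ENNReal.ofReal_mul (by norm_num),
    ← lint_inv δ L hδ hL, ← lintegral_const_mul' _ _ ENNReal.ofReal_ne_top]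
  congr 1; ext y
  rw [← ENNReal.ofReal_mul (by norm_num)]; congr 1; ring

def mker (δ x y : ℝ) : ℝ := min (4/(x-y)^2) (1/δ^2)

lemma mker_symm (δ x y : ℝ) : mker δ x y = mker δ y x := by
  unfold mker; rw [← neg_sub y x, neg_sq]

lemma mker_meas (δ : ℝ) : Measurable (fun p : ℝ × ℝ => mker δ p.1 p.2) := by
  unfold mker; fun_prop

def Gs (s δ x y : ℝ) : ℝ≥0∞ :=
  ((Ioo (s-δ) (s+δ)).indicator (fun x => ENNReal.ofReal (mker δ x y)) x +
    (Ioo (s-δ) (s+δ)).indicator (fun y => ENNReal.ofReal (mker δ x y)) y) +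
  ((Iic (s-δ)).indicator (fun x => (Ici s).indicator (fun y => ENNReal.ofReal (4/(x-y)^2)) y) x +
    (Ici (s+δ)).indicator (fun x => (Iic s).indicator (fun y => ENNReal.ofReal (4/(x-y)^2)) y) x)

lemma band1 (s δ a b : ℝ) (hδ : 0 < δ) :
    ∫⁻ x in Ioo a b, ∫⁻ y in Ioo a b,
      (Ioo (s-δ) (s+δ)).indicator (fun x => ENNReal.ofReal (mker δ x y)) x ≤ ENNReal.ofReal 20 := by
  calc _ ≤ ∫⁻ x in Ioo a b, (Ioo (s-δ) (s+δ)).indicator (fun _ => ENNReal.ofReal (10/δ)) x := by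
        apply lintegral_mono
        intro x
        by_cases hx : x ∈ Ioo (s-δ) (s+δ)
        · simp only [indicator_of_mem hx]
          exact (setLIntegral_le_lintegral _ _).trans (inner_all x δ hδ)
        · simp only [indicator_of_notMem hx]; simp
    _ ≤ ∫⁻ x, (Ioo (s-δ) (s+δ)).indicator (fun _ => ENNReal.ofReal (10/δ)) x :=
        setLIntegral_le_lintegral _ _
    _ = ENNReal.ofReal 20 := by
        rw [lintegral_indicator measurableSet_Ioo, setLIntegral_const, Real.volume_Ioo,
          ← ENNReal.ofReal_mul (by positivity)]
        congr 1; field_simp; ring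

lemma band2 (s δ a b : ℝ) (hδ : 0 < δ) :
    ∫⁻ x in Ioo a b, ∫⁻ y in Ioo a b,
      (Ioo (s-δ) (s+δ)).indicator (fun y => ENNReal.ofReal (mker δ x y)) y ≤ ENNReal.ofReal 20 := by
  rw [lintegral_lintegral_swap]
  · refine le_trans (le_of_eq ?_) (band1 s δ a b hδ)
    congr 1; ext x; congr 1; ext y
    simp only [indicator, mker_symm δ y x]
  · apply Measurable.aemeasurable
    have : (Function.uncurry fun x y => (Ioo (s-δ) (s+δ)).indicator (fun y => ENNReal.ofReal (mker δ x y)) y)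
      = (Prod.snd ⁻¹' (Ioo (s-δ) (s+δ))).indicator (fun p : ℝ × ℝ => ENNReal.ofReal (mker δ p.1 p.2)) := by
      ext p; simp only [Function.uncurry, indicator, mem_preimage]
    rw [this]
    exact (mker_meas δ).ennreal_ofReal.indicator (measurable_snd measurableSet_Ioo)

lemma far1 (s δ a b : ℝ) (hδ : 0 < δ) (hL : δ ≤ b - a) (hs : s ∈ Ioo a b) :
    ∫⁻ x in Ioo a b, ∫⁻ y in Ioo a b,
      (Iic (s-δ)).indicator (fun x => (Ici s).indicator (fun y => ENNReal.ofReal (4/(x-y)^2)) y) x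
      ≤ ENNReal.ofReal (4 * Real.log ((b-a)/δ)) := by
  rw [← outer_right s δ (b-a) hδ hL, ← lintegral_indicator measurableSet_Icc]
  refine le_trans ?_ (setLIntegral_le_lintegral (Ioo a b) _)
  apply setLIntegral_mono' measurableSet_Ioo
  intro x hx
  by_cases h : x ∈ Iic (s-δ)
  · have h' : x ≤ s - δ := h
    have hm : x ∈ Icc (s - (b-a)) (s-δ) := ⟨by linarith [hx.1, hs.2], h⟩
    simp only [indicator_of_mem h, indicator_of_mem hm]
    rw [← tail_right x s (by linarith), ← lintegral_indicator measurableSet_Ici]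
    exact setLIntegral_le_lintegral _ _
  · simp only [indicator_of_notMem h]; simp

lemma far2 (s δ a b : ℝ) (hδ : 0 < δ) (hL : δ ≤ b - a) (hs : s ∈ Ioo a b) :
    ∫⁻ x in Ioo a b, ∫⁻ y in Ioo a b,
      (Ici (s+δ)).indicator (fun x => (Iic s).indicator (fun y => ENNReal.ofReal (4/(x-y)^2)) y) x
      ≤ ENNReal.ofReal (4 * Real.log ((b-a)/δ)) := by
  rw [← outer_left s δ (b-a) hδ hL, ← lintegral_indicator measurableSet_Icc]
  refine le_trans ?_ (setLIntegral_le_lintegral (Ioo a b) _)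
  apply setLIntegral_mono' measurableSet_Ioo
  intro x hx
  by_cases h : x ∈ Ici (s+δ)
  · have h' : s + δ ≤ x := h
    have hm : x ∈ Icc (s+δ) (s + (b-a)) := ⟨h, by linarith [hx.2, hs.1]⟩
    simp only [indicator_of_mem h, indicator_of_mem hm]
    rw [← tail_left x s (by linarith), ← lintegral_indicator measurableSet_Iic]
    exact setLIntegral_le_lintegral _ _
  · simp only [indicator_of_notMem h]; simp

lemma ind_prod_meas {A B : Set ℝ} (hA : MeasurableSet A) (hB : MeasurableSet B) (f : ℝ × ℝ → ℝ≥0∞)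
    (hf : Measurable f) :
    Measurable (fun p : ℝ × ℝ => A.indicator (fun x => B.indicator (fun y => f (x,y)) p.2) p.1) := by
  have : (fun p : ℝ × ℝ => A.indicator (fun x => B.indicator (fun y => f (x,y)) p.2) p.1)
      = (A ×ˢ B).indicator f := by
    ext p; simp only [indicator, mem_prod]; split_ifs <;> simp_all
  rw [this]; exact hf.indicator (hA.prod hB)

lemma G1_meas (s δ : ℝ) : Measurable (fun p : ℝ × ℝ => (Ioo (s-δ) (s+δ)).indicator (fun x => ENNReal.ofReal (mker δ x p.2)) p.1) := by
  have := ind_prod_meas (measurableSet_Ioo (a := s-δ) (b := s+δ)) MeasurableSet.univ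
    _ (mker_meas δ).ennreal_ofReal
  simpa using this

lemma G2_meas (s δ : ℝ) : Measurable (fun p : ℝ × ℝ => (Ioo (s-δ) (s+δ)).indicator (fun y => ENNReal.ofReal (mker δ p.1 y)) p.2) := by
  have := ind_prod_meas MeasurableSet.univ (measurableSet_Ioo (a := s-δ) (b := s+δ))
    _ (mker_meas δ).ennreal_ofReal
  simpa using this

lemma quad_meas : Measurable (fun p : ℝ × ℝ => ENNReal.ofReal (4/(p.1-p.2)^2)) := by fun_prop

lemma Gs_meas (s δ : ℝ) : Measurable (fun p : ℝ × ℝ => Gs s δ p.1 p.2) := by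
  unfold Gs
  exact ((G1_meas s δ).add (G2_meas s δ)).add
    ((ind_prod_meas measurableSet_Iic measurableSet_Ici _ quad_meas).add
      (ind_prod_meas measurableSet_Ici measurableSet_Iic _ quad_meas))

lemma dint_add (f g : ℝ × ℝ → ℝ≥0∞) (hf : Measurable f) (S : Set ℝ) :
    ∫⁻ x in S, ∫⁻ y in S, (f (x,y) + g (x,y)) = (∫⁻ x in S, ∫⁻ y in S, f (x,y)) + ∫⁻ x in S, ∫⁻ y in S, g (x,y) := by
  rw [← lintegral_add_left]
  · congr 1; ext x
    rw [lintegral_add_left]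
    exact hf.comp measurable_prodMk_left
  · exact hf.lintegral_prod_right'

lemma Gs_int (s δ a b : ℝ) (hδ : 0 < δ) (hL : δ ≤ b - a) (hs : s ∈ Ioo a b) :
    ∫⁻ x in Ioo a b, ∫⁻ y in Ioo a b, Gs s δ x y ≤ ENNReal.ofReal (40 + 8 * Real.log ((b-a)/δ)) := by
  have hl : 0 ≤ Real.log ((b-a)/δ) := Real.log_nonneg (by rw [le_div_iff₀ hδ]; linarith)
  unfold Gs
  have e1 := dint_add (fun p => (Ioo (s-δ) (s+δ)).indicator (fun x => ENNReal.ofReal (mker δ x p.2)) p.1 +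
    (Ioo (s-δ) (s+δ)).indicator (fun y => ENNReal.ofReal (mker δ p.1 y)) p.2)
    (fun p => (Iic (s-δ)).indicator (fun x => (Ici s).indicator (fun y => ENNReal.ofReal (4/(x-y)^2)) p.2) p.1 +
    (Ici (s+δ)).indicator (fun x => (Iic s).indicator (fun y => ENNReal.ofReal (4/(x-y)^2)) p.2) p.1)
    ((G1_meas s δ).add (G2_meas s δ)) (Ioo a b)
  have e2 := dint_add _ (fun p => (Ioo (s-δ) (s+δ)).indicator (fun y => ENNReal.ofReal (mker δ p.1 y)) p.2)
    (G1_meas s δ) (Ioo a b)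
  have e3 := dint_add _ (fun p => (Ici (s+δ)).indicator (fun x => (Iic s).indicator (fun y => ENNReal.ofReal (4/(x-y)^2)) p.2) p.1)
    (ind_prod_meas (measurableSet_Iic (a := s - δ)) (measurableSet_Ici (a := s)) _ quad_meas) (Ioo a b)
  simp only at e1 e2 e3
  rw [e1, e2, e3]
  refine (add_le_add (add_le_add (band1 s δ a b hδ) (band2 s δ a b hδ))
    (add_le_add (far1 s δ a b hδ hL hs) (far2 s δ a b hδ hL hs))).trans ?_
  rw [← ENNReal.ofReal_add (by positivity) (by positivity),
    ← ENNReal.ofReal_add (by positivity) (by positivity),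
    ← ENNReal.ofReal_add (by positivity) (by positivity)]
  apply ENNReal.ofReal_le_ofReal
  linarith

lemma meas_section (f : ℝ × ℝ → ℝ≥0∞) (hf : Measurable f) (x : ℝ) : Measurable (fun y => f (x, y)) :=
  hf.comp measurable_prodMk_left

lemma Gs_meas_y (s δ x : ℝ) : Measurable (fun y => Gs s δ x y) :=
  meas_section (fun p => Gs s δ p.1 p.2) (Gs_meas s δ) x

lemma Gs_meas_int (s δ : ℝ) (S : Set ℝ) : Measurable (fun x => ∫⁻ y in S, Gs s δ x y) :=
  Measurable.lintegral_prod_right' (ν := volume.restrict S) (f := fun p => Gs s δ p.1 p.2) (Gs_meas s δ)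

lemma Gsum_int (F : Finset ℝ) (δ a b : ℝ) (hδ : 0 < δ) (hL : δ ≤ b - a) (hs : ∀ s ∈ F, s ∈ Ioo a b) :
    ∫⁻ x in Ioo a b, ∫⁻ y in Ioo a b, ∑ s ∈ F, Gs s δ x y ≤
      F.card * ENNReal.ofReal (40 + 8 * Real.log ((b-a)/δ)) := by
  have : ∫⁻ x in Ioo a b, ∫⁻ y in Ioo a b, ∑ s ∈ F, Gs s δ x y
      = ∑ s ∈ F, ∫⁻ x in Ioo a b, ∫⁻ y in Ioo a b, Gs s δ x y := by
    rw [← lintegral_finsetSum]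
    · congr 1; ext x
      rw [lintegral_finsetSum]
      intro s _
      exact Gs_meas_y s δ x
    · intro s _
      exact Gs_meas_int s δ _
  rw [this]
  refine (Finset.sum_le_card_nsmul _ _ _ fun s h => Gs_int s δ a b hδ hL (hs s h)).trans ?_
  rw [nsmul_eq_mul]
def ud (w : ℝ → ℝ) (S : Set ℝ) (δ x : ℝ) : ℝ := w x * min 1 (infDist x S / δ)

lemma Gs_ge1 (s δ x y : ℝ) (h : |x - s| < δ) : ENNReal.ofReal (mker δ x y) ≤ Gs s δ x y := by
  rw [abs_lt] at h
  have hm : x ∈ Ioo (s-δ) (s+δ) := ⟨by linarith, by linarith⟩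
  unfold Gs
  rw [indicator_of_mem hm]
  exact le_add_right (le_add_right le_rfl)

lemma Gs_ge2 (s δ x y : ℝ) (h : |y - s| < δ) : ENNReal.ofReal (mker δ x y) ≤ Gs s δ x y := by
  rw [abs_lt] at h
  have hm : y ∈ Ioo (s-δ) (s+δ) := ⟨by linarith, by linarith⟩
  unfold Gs
  rw [indicator_of_mem (f := (fun y => ENNReal.ofReal (mker δ x y))) hm]
  exact le_add_right (le_add_left le_rfl)

lemma Gs_ge3 (s δ x y : ℝ) (h : x ≤ s - δ) (h2 : s ≤ y) : ENNReal.ofReal (mker δ x y) ≤ Gs s δ x y := by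
  have hm : x ∈ Iic (s-δ) := h
  have hm2 : y ∈ Ici s := h2
  refine (ENNReal.ofReal_le_ofReal (min_le_left _ _)).trans ?_
  unfold Gs
  rw [indicator_of_mem (s := Iic (s-δ)) hm, indicator_of_mem (s := Ici s) hm2]
  exact le_add_left (le_add_right le_rfl)

lemma Gs_ge4 (s δ x y : ℝ) (h : s + δ ≤ x) (h2 : y ≤ s) : ENNReal.ofReal (mker δ x y) ≤ Gs s δ x y := by
  have hm : x ∈ Ici (s+δ) := h
  have hm2 : y ∈ Iic s := h2
  refine (ENNReal.ofReal_le_ofReal (min_le_left _ _)).trans ?_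
  unfold Gs
  rw [indicator_of_mem (s := Ici (s+δ)) hm, indicator_of_mem (s := Iic s) hm2]
  exact le_add_left (le_add_left le_rfl)

lemma Gs_ge_between (s δ x y : ℝ) (h : (x ≤ s ∧ s ≤ y) ∨ (y ≤ s ∧ s ≤ x)) :
    ENNReal.ofReal (mker δ x y) ≤ Gs s δ x y := by
  by_cases h1 : |x - s| < δ
  · exact Gs_ge1 s δ x y h1
  push Not at h1
  rcases h with ⟨h2, h3⟩ | ⟨h2, h3⟩
  · apply Gs_ge3 s δ x y _ h3
    rw [abs_of_nonpos (by linarith)] at h1; linarith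
  · apply Gs_ge4 s δ x y _ h2
    rw [abs_of_nonneg (by linarith)] at h1; linarith

lemma quot_le_mker (t δ x y : ℝ) (hδ : 0 < δ) (hxy : x ≠ y) (h1 : |t| ≤ 2) (h2 : |t| ≤ |x-y|/δ) :
    |t|^2/|x-y|^2 ≤ mker δ x y := by
  have hD : 0 < |x-y| := abs_pos.2 (sub_ne_zero.2 hxy)
  unfold mker
  apply le_min
  · rw [sq_abs (x-y)]
    apply div_le_div_of_nonneg_right _ (sq_nonneg _)
    nlinarith [abs_nonneg t]
  · rw [div_le_div_iff₀ (by positivity) (by positivity), one_mul, ← mul_pow]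
    apply pow_le_pow_left₀ (by positivity)
    rwa [← le_div_iff₀ hδ]

lemma near_pt (F : Finset ℝ) (b δ x : ℝ) (hδ1 : δ < 1) (hx : x < b)
    (h : infDist x (insert (b+1) (F : Set ℝ)) < δ) : ∃ s ∈ F, |x - s| < δ := by
  rw [infDist_lt_iff (insert_nonempty _ _)] at h
  obtain ⟨s, hs, hd⟩ := h
  rw [Real.dist_eq] at hd
  rcases hs with rfl | hs
  · rw [abs_lt] at hd; linarith [hd.1]
  · exact ⟨s, hs, hd⟩

lemma ud_abs_le (w : ℝ → ℝ) (hw : ∀ x, w x = 1 ∨ w x = -1) (S : Set ℝ) (δ x : ℝ) (hδ : 0 < δ) :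
    |ud w S δ x| ≤ min 1 (infDist x S / δ) := by
  have h0 : 0 ≤ infDist x S / δ := div_nonneg infDist_nonneg hδ.le
  have h1 : |w x| = 1 := by rcases hw x with h | h <;> rw [h] <;> simp
  unfold ud
  rw [abs_mul, h1, one_mul, abs_of_nonneg (le_min zero_le_one h0)]

lemma ud_diff_same (w : ℝ → ℝ) (hw : ∀ x, w x = 1 ∨ w x = -1) (S : Set ℝ) (δ x y : ℝ) (hδ : 0 < δ)
    (hxy : w x = w y) : |ud w S δ x - ud w S δ y| ≤ |x - y| / δ := by
  have h1 : |w y| = 1 := by rcases hw y with h | h <;> rw [h] <;> simp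
  unfold ud
  rw [hxy, ← mul_sub, abs_mul, h1, one_mul]
  have h2 := abs_min_sub_min_le_max 1 (infDist x S / δ) 1 (infDist y S / δ)
  refine h2.trans ?_
  rw [sub_self, abs_zero, ← sub_div, abs_div, abs_of_pos hδ]
  apply max_le (by positivity)
  apply div_le_div_of_nonneg_right _ hδ.le
  have h3 := (lipschitz_infDist_pt S).dist_le_mul x y
  simpa [Real.dist_eq] using h3

lemma ud_pointwise (w : ℝ → ℝ) (hw : ∀ x, w x = 1 ∨ w x = -1) (F : Finset ℝ) (a b δ : ℝ)
    (hconst : ∀ x ∈ Ioo a b, ∀ y ∈ Ioo a b, x ≤ y → (∀ s ∈ F, ¬ (x ≤ s ∧ s ≤ y)) → w x = w y)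
    (hδ : 0 < δ) (hδ1 : δ < 1) (x y : ℝ) (hx : x ∈ Ioo a b) (hy : y ∈ Ioo a b) :
    ENNReal.ofReal (|ud w (insert (b+1) (F : Set ℝ)) δ x - ud w (insert (b+1) (F : Set ℝ)) δ y| ^ 2
      / |x - y| ^ 2) ≤ ∑ s ∈ F, Gs s δ x y := by
  set S : Set ℝ := insert (b+1) (F : Set ℝ) with hS
  by_cases hxy : x = y
  · simp [hxy]
  have hax := ud_abs_le w hw S δ x hδ
  have hay := ud_abs_le w hw S δ y hδ
  have ht2 : |ud w S δ x - ud w S δ y| ≤ 2 := by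
    refine (abs_sub _ _).trans ?_
    linarith [min_le_left 1 (infDist x S / δ), min_le_left 1 (infDist y S / δ)]
  have single : ∀ s ∈ F, Gs s δ x y ≤ ∑ s ∈ F, Gs s δ x y := fun s hs =>
    Finset.single_le_sum (f := fun s => Gs s δ x y) (fun _ _ => zero_le) hs
  by_cases hb : ∃ s ∈ F, (x ≤ s ∧ s ≤ y) ∨ (y ≤ s ∧ s ≤ x)
  · obtain ⟨s, hsF, hs⟩ := hb
    have hsS : s ∈ S := mem_insert_of_mem _ hsF
    have dx : infDist x S ≤ |x - s| := infDist_le_dist_of_mem hsS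
    have dy : infDist y S ≤ |y - s| := infDist_le_dist_of_mem hsS
    have hsum : |x - s| + |y - s| = |x - y| := by
      rcases hs with ⟨h1, h2⟩ | ⟨h1, h2⟩
      · rw [abs_of_nonpos (by linarith : x - s ≤ 0), abs_of_nonneg (by linarith : 0 ≤ y - s),
          abs_of_nonpos (by linarith : x - y ≤ 0)]; ring
      · rw [abs_of_nonneg (by linarith : 0 ≤ x - s), abs_of_nonpos (by linarith : y - s ≤ 0),
          abs_of_nonneg (by linarith : 0 ≤ x - y)]; ring
    have ht : |ud w S δ x - ud w S δ y| ≤ |x - y| / δ := by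
      refine (abs_sub _ _).trans ?_
      rw [← hsum, add_div]
      have e1 := div_le_div_of_nonneg_right dx hδ.le
      have e2 := div_le_div_of_nonneg_right dy hδ.le
      linarith [min_le_right 1 (infDist x S / δ), min_le_right 1 (infDist y S / δ)]
    exact (ENNReal.ofReal_le_ofReal (quot_le_mker _ δ x y hδ hxy ht2 ht)).trans
      ((Gs_ge_between s δ x y hs).trans (single s hsF))
  · push Not at hb
    have hwxy : w x = w y := by
      rcases le_total x y with h | h
      · exact hconst x hx y hy h (fun s hs hc => by linarith [(hb s hs).1 hc.1, hc.2])
      · exact (hconst y hy x hx h (fun s hs hc => by linarith [(hb s hs).2 hc.1, hc.2])).symm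
    have ht := ud_diff_same w hw S δ x y hδ hwxy
    have hq := ENNReal.ofReal_le_ofReal (quot_le_mker _ δ x y hδ hxy ht2 ht)
    by_cases h1 : infDist x S < δ
    · obtain ⟨s, hs, hd⟩ := near_pt F b δ x hδ1 hx.2 h1
      exact hq.trans ((Gs_ge1 s δ x y hd).trans (single s hs))
    by_cases h2 : infDist y S < δ
    · obtain ⟨s, hs, hd⟩ := near_pt F b δ y hδ1 hy.2 h2
      exact hq.trans ((Gs_ge2 s δ x y hd).trans (single s hs))
    push Not at h1 h2
    have : ud w S δ x - ud w S δ y = 0 := by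
      unfold ud
      rw [min_eq_left ((one_le_div hδ).2 h1), min_eq_left ((one_le_div hδ).2 h2), hwxy, sub_self]
    rw [this]; simp

lemma ud_kernel (w : ℝ → ℝ) (hw : ∀ x, w x = 1 ∨ w x = -1) (F : Finset ℝ) (a b δ : ℝ)
    (hF : ∀ s ∈ F, s ∈ Ioo a b)
    (hconst : ∀ x ∈ Ioo a b, ∀ y ∈ Ioo a b, x ≤ y → (∀ s ∈ F, ¬ (x ≤ s ∧ s ≤ y)) → w x = w y)
    (hδ : 0 < δ) (hδ1 : δ < 1) (hL : δ ≤ b - a) :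
    ∫⁻ x in Ioo a b, ∫⁻ y in Ioo a b,
      ENNReal.ofReal (|ud w (insert (b+1) (F : Set ℝ)) δ x - ud w (insert (b+1) (F : Set ℝ)) δ y| ^ 2
      / |x - y| ^ 2) ≤ F.card * ENNReal.ofReal (40 + 8 * Real.log ((b-a)/δ)) := by
  refine le_trans ?_ (Gsum_int F δ a b hδ hL hF)
  apply setLIntegral_mono' measurableSet_Ioo
  intro x hx
  apply setLIntegral_mono' measurableSet_Ioo
  intro y hy
  exact ud_pointwise w hw F a b δ hconst hδ hδ1 x y hx hy

lemma near_int (F : Finset ℝ) (a b δ : ℝ) (C : ℝ≥0∞) (f : ℝ → ℝ≥0∞)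
    (h1 : ∀ x ∈ Ioo a b, f x ≤ C) (h2 : ∀ x ∈ Ioo a b, (∀ s ∈ F, δ ≤ |x - s|) → f x = 0) :
    ∫⁻ x in Ioo a b, f x ≤ F.card * (C * ENNReal.ofReal (2*δ)) := by
  calc _ ≤ ∫⁻ x in Ioo a b, ∑ s ∈ F, (Ioo (s-δ) (s+δ)).indicator (fun _ => C) x := by
        apply setLIntegral_mono' measurableSet_Ioo
        intro x hx
        by_cases h : ∀ s ∈ F, δ ≤ |x - s|
        · rw [h2 x hx h]; exact zero_le
        · push Not at h
          obtain ⟨s, hs, hd⟩ := h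
          rw [abs_lt] at hd
          have hm : x ∈ Ioo (s-δ) (s+δ) := ⟨by linarith, by linarith⟩
          refine le_trans ?_ (Finset.single_le_sum
            (f := fun s => (Ioo (s-δ) (s+δ)).indicator (fun _ => C) x) (fun _ _ => zero_le) hs)
          simp only [indicator_of_mem hm]
          exact h1 x hx
    _ ≤ ∫⁻ x, ∑ s ∈ F, (Ioo (s-δ) (s+δ)).indicator (fun _ => C) x := setLIntegral_le_lintegral _ _
    _ = ∑ s ∈ F, C * ENNReal.ofReal (2*δ) := by
        rw [lintegral_finsetSum]
        · apply Finset.sum_congr rfl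
          intro s _
          rw [lintegral_indicator measurableSet_Ioo, setLIntegral_const, Real.volume_Ioo]
          congr 2; ring
        · intro s _
          exact measurable_const.indicator measurableSet_Ioo
    _ = _ := by rw [Finset.sum_const, nsmul_eq_mul]

lemma ud_far (w : ℝ → ℝ) (F : Finset ℝ) (b δ x : ℝ) (hδ : 0 < δ) (hδ1 : δ < 1) (hx : x < b)
    (h : ∀ s ∈ F, δ ≤ |x - s|) : ud w (insert (b+1) (F : Set ℝ)) δ x = w x := by
  have : δ ≤ infDist x (insert (b+1) (F : Set ℝ)) := by
    by_contra hc
    push Not at hc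
    obtain ⟨s, hs, hd⟩ := near_pt F b δ x hδ1 hx hc
    linarith [h s hs]
  unfold ud
  rw [min_eq_left ((one_le_div hδ).2 this), mul_one]

lemma ud_abs_le_one (w : ℝ → ℝ) (hw : ∀ x, w x = 1 ∨ w x = -1) (S : Set ℝ) (δ x : ℝ) (hδ : 0 < δ) :
    |ud w S δ x| ≤ 1 := (ud_abs_le w hw S δ x hδ).trans (min_le_left _ _)

lemma ud_measurable (w : ℝ → ℝ) (hw : Measurable w) (S : Set ℝ) (δ : ℝ) : Measurable (ud w S δ) := by
  unfold ud
  have : Measurable (fun x => infDist x S) := (continuous_infDist_pt S).measurable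
  fun_prop

lemma ud_pot (W : ℝ → ℝ) (hW : DoubleWell W) (M : ℝ) (hM : ∀ t, |t| ≤ 1 → W t ≤ M)
    (w : ℝ → ℝ) (hw : ∀ x, w x = 1 ∨ w x = -1) (F : Finset ℝ) (a b δ : ℝ)
    (hδ : 0 < δ) (hδ1 : δ < 1) :
    ∫⁻ x in Ioo a b, ENNReal.ofReal (W (ud w (insert (b+1) (F : Set ℝ)) δ x)) ≤
      F.card * (ENNReal.ofReal M * ENNReal.ofReal (2*δ)) := by
  apply near_int
  · intro x _
    exact ENNReal.ofReal_le_ofReal (hM _ (ud_abs_le_one w hw _ δ x hδ))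
  · intro x hx h
    rw [ud_far w F b δ x hδ hδ1 hx.2 h]
    rcases hw x with e | e <;> rw [e] <;> simp [hW.2.2.1, hW.2.2.2.1]

lemma ud_L1 (w : ℝ → ℝ) (hw : ∀ x, w x = 1 ∨ w x = -1) (F : Finset ℝ) (a b δ : ℝ)
    (hδ : 0 < δ) (hδ1 : δ < 1) :
    ∫⁻ x in Ioo a b, ENNReal.ofReal |ud w (insert (b+1) (F : Set ℝ)) δ x - w x| ≤
      F.card * (ENNReal.ofReal 2 * ENNReal.ofReal (2*δ)) := by
  apply near_int
  · intro x _
    apply ENNReal.ofReal_le_ofReal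
    have := ud_abs_le_one w hw (insert (b+1) (F : Set ℝ)) δ x hδ
    have h1 : |w x| = 1 := by rcases hw x with h | h <;> rw [h] <;> simp
    exact (abs_sub _ _).trans (by linarith)
  · intro x hx h
    rw [ud_far w F b δ x hδ hδ1 hx.2 h]; simp
lemma eps_log_eps : Tendsto (fun ε : ℝ => ε * Real.log ε) (𝓝[>] 0) (𝓝 0) := by
  have := Real.continuous_mul_log.tendsto 0
  simp only [zero_mul] at this
  exact this.mono_left nhdsWithin_le_nhds

lemma id_zero : Tendsto (fun ε : ℝ => ε) (𝓝[>] 0) (𝓝 0) := nhdsWithin_le_nhds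

lemma gamma_limsup (W : ℝ → ℝ) (hW : DoubleWell W) (k : ℝ) (hk : 0 < k) (μ : ℝ → ℝ)
    (hμ : ∀ ε, 0 < ε → 0 < μ ε)
    (hlim : Tendsto (fun ε => ε * Real.log (μ ε)) (𝓝[>] (0:ℝ)) (𝓝 k))
    (a b : ℝ) (hab : a < b) (v : ℝ → ℝ) (hv : Measurable v) (hvi : IntegrableOn v (Ioo a b)) :
    ∃ vε : ℝ → ℝ → ℝ, (∀ ε ∈ Ioi (0:ℝ), Measurable (vε ε) ∧ IntegrableOn (vε ε) (Ioo a b)) ∧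
      Tendsto (fun ε => ∫⁻ x in Ioo a b, ENNReal.ofReal |vε ε x - v x|) (𝓝[>] (0:ℝ)) (𝓝 0) ∧
      limsup (fun ε => ENNReal.ofReal ε * (∫⁻ x in Ioo a b, ∫⁻ y in Ioo a b,
          ENNReal.ofReal (|vε ε x - vε ε y|^2/|x-y|^2))
        + ENNReal.ofReal (μ ε) * (∫⁻ x in Ioo a b, ENNReal.ofReal (W (vε ε x)))) (𝓝[>] (0:ℝ))
      ≤ G1lim k v (Ioo a b) := by
  by_cases hc : (∀ᵐ x ∂(volume.restrict (Ioo a b)), v x = 1 ∨ v x = -1) ∧ (jumpSet v (Ioo a b)).Finite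
  swap
  · refine ⟨fun _ => v, fun _ _ => ⟨hv, hvi⟩, by simp, ?_⟩
    unfold G1lim
    rw [if_neg hc]; exact le_top
  obtain ⟨hae, hfin⟩ := hc
  obtain ⟨w, hwm, hw, hconst, hwv⟩ := step_rep a b v hae hfin
  set F : Finset ℝ := hfin.toFinset with hFdef
  have hF : ∀ s ∈ F, s ∈ Ioo a b := by
    intro s hs
    rw [hFdef, Set.Finite.mem_toFinset] at hs
    exact hs.1
  have hconst' : ∀ x ∈ Ioo a b, ∀ y ∈ Ioo a b, x ≤ y → (∀ s ∈ F, ¬ (x ≤ s ∧ s ≤ y)) → w x = w y := by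
    intro x hx y hy hxy h
    exact hconst x hx y hy hxy fun s hs => h s (by rw [hFdef, Set.Finite.mem_toFinset]; exact hs)
  obtain ⟨M, hM0, hM⟩ : ∃ M : ℝ, 0 ≤ M ∧ ∀ t, |t| ≤ 1 → W t ≤ M := by
    obtain ⟨M, hM⟩ := (isCompact_Icc (a := (-1:ℝ)) (b := 1)).bddAbove_image hW.1.continuous.continuousOn
    refine ⟨M, ?_, fun t ht => hM ⟨t, abs_le.1 ht, rfl⟩⟩
    exact (hW.2.1 0).trans (hM ⟨0, by norm_num, rfl⟩)
  set S : Set ℝ := insert (b+1) (F : Set ℝ) with hS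
  have hμt := mu_atTop k hk μ hμ hlim
  have hδ0 : Tendsto (fun ε => ε / μ ε) (𝓝[>] (0:ℝ)) (𝓝 0) := id_zero.div_atTop hμt
  have hpos : ∀ ε, 0 < ε → 0 < ε / μ ε := fun ε hε => div_pos hε (hμ ε hε)
  have hev : ∀ᶠ ε in 𝓝[>] (0:ℝ), 0 < ε ∧ ε / μ ε < 1 ∧ ε / μ ε ≤ b - a := by
    filter_upwards [self_mem_nhdsWithin, hδ0.eventually (gt_mem_nhds zero_lt_one),
      hδ0.eventually (gt_mem_nhds (sub_pos.2 hab))] with ε h1 h2 h3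
    exact ⟨h1, h2, h3.le⟩
  have hN : (jumpSet v (Ioo a b)).ncard = F.card := Set.ncard_eq_toFinset_card _ hfin
  refine ⟨fun ε => ud w S (ε / μ ε), ?_, ?_, ?_⟩
  · intro ε hε
    have hm := ud_measurable w hwm S (ε / μ ε)
    refine ⟨hm, ?_⟩
    refine Measure.integrableOn_of_bounded (M := 1) (by simp) hm.aestronglyMeasurable ?_
    exact Eventually.of_forall fun x => ud_abs_le_one w hw S _ x (hpos ε hε)
  · have hup : Tendsto (fun ε => (F.card : ℝ≥0∞) * (ENNReal.ofReal 2 * ENNReal.ofReal (2*(ε/μ ε))))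
        (𝓝[>] (0:ℝ)) (𝓝 0) := by
      have h1 : Tendsto (fun ε => ENNReal.ofReal (2*(ε/μ ε))) (𝓝[>] (0:ℝ)) (𝓝 0) := by
        have := ENNReal.tendsto_ofReal (hδ0.const_mul 2)
        simpa using this
      have h2 := ENNReal.Tendsto.const_mul h1 (a := ENNReal.ofReal 2) (Or.inr ENNReal.ofReal_ne_top)
      have h3 := ENNReal.Tendsto.const_mul h2 (a := (F.card : ℝ≥0∞)) (Or.inr (ENNReal.natCast_ne_top _))
      simpa using h3
    refine tendsto_of_tendsto_of_tendsto_of_le_of_le' tendsto_const_nhds hup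
      (Eventually.of_forall fun _ => zero_le) ?_
    filter_upwards [hev] with ε hε
    refine le_trans (le_of_eq ?_) (ud_L1 w hw F a b (ε/μ ε) (hpos ε hε.1) hε.2.1)
    apply lintegral_congr_ae
    filter_upwards [hwv] with x hx
    rw [hx]
  · have hg : Tendsto (fun ε => (F.card : ℝ) * (40 * ε + 8 * (Real.log (b-a) * ε + ε * Real.log (μ ε)
        - ε * Real.log ε)) + 2 * F.card * M * ε) (𝓝[>] (0:ℝ)) (𝓝 (8 * k * F.card)) := by
      have h := (((id_zero.const_mul 40).add ((((id_zero.const_mul (Real.log (b-a))).add hlim).sub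
        eps_log_eps).const_mul 8)).const_mul (F.card : ℝ)).add (id_zero.const_mul (2 * F.card * M))
      convert h using 2
      ring
    have hg2 := (ENNReal.tendsto_ofReal hg).limsup_eq
    unfold G1lim
    rw [if_pos ⟨hae, hfin⟩, hN, ← hg2]
    refine limsup_le_limsup ?_
    filter_upwards [hev] with ε ⟨hε, hε1, hε2⟩
    have hd := hpos ε hε
    have hm := hμ ε hε
    have hlog : 0 ≤ Real.log ((b-a)/(ε/μ ε)) := Real.log_nonneg (by rw [le_div_iff₀ hd]; linarith)
    refine (add_le_add (mul_le_mul_right (ud_kernel w hw F a b _ hF hconst' hd hε1 hε2) _)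
      (mul_le_mul_right (ud_pot W hW M hM w hw F a b _ hd hε1) _)).trans ?_
    rw [← ENNReal.ofReal_natCast, ← ENNReal.ofReal_mul hM0, ← ENNReal.ofReal_mul (Nat.cast_nonneg _),
      ← ENNReal.ofReal_mul (Nat.cast_nonneg _), ← ENNReal.ofReal_mul hε.le, ← ENNReal.ofReal_mul hm.le,
      ← ENNReal.ofReal_add (by positivity) (by positivity)]
    apply ENNReal.ofReal_le_ofReal
    apply le_of_eq
    have hL : 0 < b - a := sub_pos.2 hab
    rw [Real.log_div hL.ne' hd.ne', Real.log_div hε.ne' hm.ne']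
    have e : μ ε * (↑F.card * (M * (2 * (ε / μ ε)))) = 2 * F.card * M * ε := by
      field_simp
    rw [e]; ring

lemma G1eps_eq (W lam : ℝ → ℝ) (ε : ℝ) (hε : 0 < ε) (hl : 0 < lam ε) (v : ℝ → ℝ) (a b : ℝ) (hab : a < b) :
    G1eps W lam ε v (Ioo a b) = ENNReal.ofReal ε * (∫⁻ x in Ioo a b, ∫⁻ y in Ioo a b,
          ENNReal.ofReal (|v x - v y|^2/|x-y|^2))
        + ENNReal.ofReal (ε * (b-a)^2 * lam ε) * (∫⁻ x in Ioo a b, ENNReal.ofReal (W (v x))) := by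
  have hL : 0 < b - a := sub_pos.2 hab
  unfold G1eps
  set P := ∫⁻ x in Ioo a b, ENNReal.ofReal (W (v x)) with hP
  have h1 : ∀ x, ∫⁻ y in Ioo a b, (ENNReal.ofReal (|v x - v y|^2/|x-y|^2) + ENNReal.ofReal (lam ε) * P)
      = (∫⁻ y in Ioo a b, ENNReal.ofReal (|v x - v y|^2/|x-y|^2)) +
        ENNReal.ofReal (lam ε) * P * ENNReal.ofReal (b-a) := by
    intro x
    rw [lintegral_add_right _ measurable_const, setLIntegral_const, Real.volume_Ioo]
  simp only [h1]
  rw [lintegral_add_right _ measurable_const, setLIntegral_const, Real.volume_Ioo, mul_add,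
    ENNReal.ofReal_mul (by positivity), ENNReal.ofReal_mul (by positivity),
    ENNReal.ofReal_pow hL.le]
  ring

lemma mu_lim (lam : ℝ → ℝ) (hlam : ∀ ε ∈ Ioi (0:ℝ), 0 < lam ε) (k a b : ℝ) (hab : a < b)
    (hklim : Tendsto (fun ε => ε * Real.log (lam ε)) (𝓝[>] (0:ℝ)) (𝓝 k)) :
    Tendsto (fun ε => ε * Real.log (ε * (b-a)^2 * lam ε)) (𝓝[>] (0:ℝ)) (𝓝 k) := by
  have hL : 0 < b - a := sub_pos.2 hab
  have h := (eps_log_eps.add (id_zero.mul_const (Real.log ((b-a)^2)))).add hklim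
  simp only [zero_mul, zero_add] at h
  refine h.congr' ?_
  filter_upwards [self_mem_nhdsWithin] with ε hε
  have hε : 0 < ε := hε
  have hl := hlam ε hε
  rw [Real.log_mul (by positivity) hl.ne', Real.log_mul hε.ne' (by positivity)]
  ring

/-- **Alberti–Bouchitté–Seppecher.** Let `I = (a,b)`, `W` a double-well
potential with zeros at `±1`, and `λ_ε > 0` with `ε log λ_ε → k ∈ (0,∞)` as `ε → 0⁺`.
Then `G¹_ε(v) = ε ∬_{I×I} |v(x)−v(y)|²/|x−y|² + λ_ε ∫_I W(v)` Γ-converges, in the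
`L¹(I)` topology, to `G¹(v) = 8k · H⁰(Sv)` for `v ∈ BV(I,{−1,1})`, `+∞` otherwise. -/
theorem gammaConv_ABS_one_dimensional
    (a b : ℝ) (hab : a < b) (W : ℝ → ℝ) (hW : DoubleWell W)
    (k : ℝ) (hk : 0 < k)
    (lam : ℝ → ℝ) (hlam : ∀ ε ∈ Set.Ioi (0:ℝ), 0 < lam ε)
    (hklim : Tendsto (fun ε => ε * Real.log (lam ε)) (𝓝[>] (0:ℝ)) (𝓝 k)) :
    (∀ v : ℝ → ℝ, Measurable v → IntegrableOn v (Set.Ioo a b) →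
      ∀ vε : ℝ → ℝ → ℝ,
        (∀ ε ∈ Set.Ioi (0:ℝ), Measurable (vε ε) ∧ IntegrableOn (vε ε) (Set.Ioo a b)) →
        Tendsto (fun ε => ∫⁻ x in Set.Ioo a b, ENNReal.ofReal |vε ε x - v x|)
          (𝓝[>] (0:ℝ)) (𝓝 0) →
        G1lim k v (Set.Ioo a b) ≤
          liminf (fun ε => G1eps W lam ε (vε ε) (Set.Ioo a b)) (𝓝[>] (0:ℝ))) ∧
    (∀ v : ℝ → ℝ, Measurable v → IntegrableOn v (Set.Ioo a b) →
      ∃ vε : ℝ → ℝ → ℝ,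
        (∀ ε ∈ Set.Ioi (0:ℝ), Measurable (vε ε) ∧ IntegrableOn (vε ε) (Set.Ioo a b)) ∧
        Tendsto (fun ε => ∫⁻ x in Set.Ioo a b, ENNReal.ofReal |vε ε x - v x|)
          (𝓝[>] (0:ℝ)) (𝓝 0) ∧
        limsup (fun ε => G1eps W lam ε (vε ε) (Set.Ioo a b)) (𝓝[>] (0:ℝ)) ≤
          G1lim k v (Set.Ioo a b)) := by
  set μ : ℝ → ℝ := fun ε => ε * (b-a)^2 * lam ε with hμdef
  have hL : 0 < b - a := sub_pos.2 hab
  have hμ : ∀ ε, 0 < ε → 0 < μ ε := fun ε hε => by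
    have := hlam ε hε
    simp only [hμdef]; positivity
  have hμlim := mu_lim lam hlam k a b hab hklim
  have heq : ∀ vε : ℝ → ℝ → ℝ, (fun ε => G1eps W lam ε (vε ε) (Ioo a b)) =ᶠ[𝓝[>] (0:ℝ)]
      (fun ε => ENNReal.ofReal ε * (∫⁻ x in Ioo a b, ∫⁻ y in Ioo a b,
          ENNReal.ofReal (|vε ε x - vε ε y|^2/|x-y|^2))
        + ENNReal.ofReal (μ ε) * (∫⁻ x in Ioo a b, ENNReal.ofReal (W (vε ε x)))) := by
    intro vε
    filter_upwards [self_mem_nhdsWithin] with ε hε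
    exact G1eps_eq W lam ε hε (hlam ε hε) (vε ε) a b hab
  constructor
  · intro v hv _ vε hvε hconv
    rw [liminf_congr (heq vε)]
    exact gamma_liminf W hW k hk μ hμ hμlim a b v hv vε (fun ε hε => (hvε ε hε).1) hconv
  · intro v hv hvi
    obtain ⟨vε, h1, h2, h3⟩ := gamma_limsup W hW k hk μ hμ hμlim a b hab v hv hvi
    refine ⟨vε, h1, h2, ?_⟩
    rw [limsup_congr (heq vε)]
    exact h3

end
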